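/- Let G = (V,E) be a bridgeless finite multigraph all of whose flow roots (roots of F(G,q) over ℂ) are real. If some flow root of G is not in the set {1,2,3}, then |V| + 17 ≤ |E| < (32|V| − 49)/5, and F(G,q) has at least 9 roots, counted with multiplicity, in the open interval (1,2). -/

import Mathlib

/-- A finite multigraph on vertex type `V` with edge type `E`: each edge `e` has two
(possibly equal) endpoints `fst e` and `snd e`. -/
structure Multigraph (V E : Type) where
  fst : E → V
  snd : E → V

namespace Multigraph

variable {V E : Type}

/-- `a` and `b` are joined by some edge belonging to the edge set `F`. -/
def edgeRelOn (G : Multigraph V E) (F : Set E) (a b : V) : Prop :=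
  ∃ e ∈ F, (G.fst e = a ∧ G.snd e = b) ∨ (G.fst e = b ∧ G.snd e = a)

/-- Reachability in the spanning subgraph `(V, F)`. -/
def Reach (G : Multigraph V E) (F : Set E) : V → V → Prop :=
  Relation.EqvGen (G.edgeRelOn F)

/-- The setoid on `V` whose classes are the connected components of the
spanning subgraph `(V, F)`. -/
def reachSetoid (G : Multigraph V E) (F : Set E) : Setoid V :=
  Relation.EqvGen.setoid (G.edgeRelOn F)

/-- The number of connected components of the spanning subgraph `(V, F)`. -/
noncomputable def ncomp (G : Multigraph V E) (F : Set E) : ℕ :=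
  Nat.card (Quotient (G.reachSetoid F))

/-- The number of connected components of `G`. -/
noncomputable def numComponents (G : Multigraph V E) : ℕ :=
  G.ncomp Set.univ

/-- `G` is connected. -/
def Connected (G : Multigraph V E) : Prop :=
  G.numComponents = 1

/-- An edge is a bridge if deleting it increases the number of connected components. -/
def IsBridge (G : Multigraph V E) (e : E) : Prop :=
  G.numComponents < G.ncomp {e' | e' ≠ e}

/-- `G` has no bridge. -/
def Bridgeless (G : Multigraph V E) : Prop :=
  ∀ e, ¬ G.IsBridge e

/-- `G` has no loops. -/
def Loopless (G : Multigraph V E) : Prop :=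
  ∀ e, G.fst e ≠ G.snd e

/-- Deleting a set `S` of vertices (and all edges meeting `S`). -/
def deleteVerts (G : Multigraph V E) (S : Set V) :
    Multigraph {v // v ∉ S} {e // G.fst e ∉ S ∧ G.snd e ∉ S} where
  fst := fun e => ⟨G.fst e.1, e.2.1⟩
  snd := fun e => ⟨G.snd e.1, e.2.2⟩

/-- A cut-vertex: a vertex whose deletion increases the number of components. -/
def IsCutVertex (G : Multigraph V E) (x : V) : Prop :=
  G.numComponents < (G.deleteVerts {x}).numComponents

/-- A graph is non-separable if it has at most one vertex and at most one edge, or it is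
connected, loopless and has no cut-vertex. -/
def NonSeparable (G : Multigraph V E) : Prop :=
  (Nat.card V ≤ 1 ∧ Nat.card E ≤ 1) ∨
    (G.Connected ∧ G.Loopless ∧ ∀ x, ¬ G.IsCutVertex x)

/-- The degree of a vertex, counted with edge multiplicity; a loop contributes `2`. -/
noncomputable def degree (G : Multigraph V E) (v : V) : ℕ :=
  Nat.card {e | G.fst e = v} + Nat.card {e | G.snd e = v}

/-- The flow polynomial `F(G,q) = ∑_{E'⊆E} (−1)^{|E|−|E'|} q^{|E'|+c(E')−|V|}`,
where `c(E')` is the number of connected components of the spanning subgraph `(V,E')`. -/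
noncomputable def flowPoly (G : Multigraph V E) [Finite V] [Finite E] : Polynomial ℝ :=
  letI : Fintype E := Fintype.ofFinite E
  ∑ E' : Finset E, (-1 : Polynomial ℝ) ^ (Nat.card E - E'.card) *
    Polynomial.X ^ (E'.card + G.ncomp ↑E' - Nat.card V)

/-- A subgraph of a multigraph: a set of vertices and a set of edges with both
endpoints among those vertices. -/
structure Subgraph (G : Multigraph V E) where
  verts : Set V
  edges : Set E
  fst_mem : ∀ ⦃e⦄, e ∈ edges → G.fst e ∈ verts
  snd_mem : ∀ ⦃e⦄, e ∈ edges → G.snd e ∈ verts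

/-- A subgraph, viewed as a multigraph in its own right. -/
def Subgraph.toMultigraph {G : Multigraph V E} (H : G.Subgraph) :
    Multigraph H.verts H.edges where
  fst := fun e => ⟨G.fst e.1, H.fst_mem e.2⟩
  snd := fun e => ⟨G.snd e.1, H.snd_mem e.2⟩

/-- `H` is a connected component of `G`: its vertex set is the set of vertices reachable
from some vertex, and its edges are all the edges of `G` joining its vertices. -/
def IsComponent {G : Multigraph V E} (H : G.Subgraph) : Prop :=
  (∃ v ∈ H.verts, ∀ u, u ∈ H.verts ↔ G.Reach Set.univ v u) ∧
    ∀ e, e ∈ H.edges ↔ (G.fst e ∈ H.verts ∧ G.snd e ∈ H.verts)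

/-- `H` is a block of `G`: a maximal non-separable subgraph. -/
def IsBlock {G : Multigraph V E} (H : G.Subgraph) : Prop :=
  H.toMultigraph.NonSeparable ∧
    ∀ H' : G.Subgraph, H'.toMultigraph.NonSeparable →
      H.verts ⊆ H'.verts → H.edges ⊆ H'.edges → H' = H

/-- A trivial block: a single vertex and no edges. -/
def Subgraph.IsTrivial {G : Multigraph V E} (H : G.Subgraph) : Prop :=
  (∃ v, H.verts = {v}) ∧ H.edges = ∅

/-- An orientation of a multigraph: each edge is given a tail and a head,
consistent with its two endpoints. -/
structure Orientation (G : Multigraph V E) where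
  tail : E → V
  head : E → V
  consistent : ∀ e, (tail e = G.fst e ∧ head e = G.snd e) ∨
    (tail e = G.snd e ∧ head e = G.fst e)

open Classical in
/-- A `Γ`-flow on an orientation `D`: at every vertex, the sum of the values on
the arcs with that tail equals the sum of the values on the arcs with that head. -/
noncomputable def Orientation.IsFlow {G : Multigraph V E} [Fintype E]
    (D : G.Orientation) {Γ : Type} [AddCommGroup Γ] (φ : E → Γ) : Prop :=
  ∀ v : V, ∑ e ∈ Finset.univ.filter (fun e => D.tail e = v), φ e =
    ∑ e ∈ Finset.univ.filter (fun e => D.head e = v), φ e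

/-- Deleting an edge. -/
def deleteEdge (G : Multigraph V E) (e₀ : E) : Multigraph V {e // e ≠ e₀} where
  fst := fun e => G.fst e.1
  snd := fun e => G.snd e.1

/-- Adding a new edge joining `x` and `y`. -/
def addEdge (G : Multigraph V E) (x y : V) : Multigraph V (E ⊕ Unit) where
  fst := Sum.elim G.fst fun _ => x
  snd := Sum.elim G.snd fun _ => y

/-- Contracting a set `F` of edges: vertices joined through `F` are identified,
and the edges of `F` are removed. -/
def contract (G : Multigraph V E) (F : Set E) :
    Multigraph (Quotient (G.reachSetoid F)) {e // e ∉ F} where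
  fst := fun e => Quotient.mk _ (G.fst e.1)
  snd := fun e => Quotient.mk _ (G.snd e.1)

/-- The number of proper colourings of the vertices of `G` with `n` colours. -/
noncomputable def properColorings (G : Multigraph V E) (n : ℕ) : ℕ :=
  Nat.card {f : V → Fin n // ∀ e, f (G.fst e) ≠ f (G.snd e)}

/-- An isomorphism of multigraphs. -/
structure Iso {V' E' : Type} (G : Multigraph V E) (G' : Multigraph V' E') where
  vmap : V ≃ V'
  emap : E ≃ E'
  ends : ∀ e, (G'.fst (emap e) = vmap (G.fst e) ∧ G'.snd (emap e) = vmap (G.snd e)) ∨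
    (G'.fst (emap e) = vmap (G.snd e) ∧ G'.snd (emap e) = vmap (G.fst e))

open Classical in
/-- Subdividing the edge `e₀`: it is replaced by a path of length two through a new vertex. -/
noncomputable def subdivide (G : Multigraph V E) (e₀ : E) :
    Multigraph (V ⊕ Unit) (E ⊕ Unit) where
  fst := Sum.elim (fun e => Sum.inl (G.fst e)) fun _ => Sum.inr ()
  snd := Sum.elim (fun e => if e = e₀ then Sum.inr () else Sum.inl (G.snd e))
    fun _ => Sum.inl (G.snd e₀)

/-- `G` is a subdivision of `H`. -/
inductive IsSubdivisionOf :
    {V E V' E' : Type} → Multigraph V E → Multigraph V' E' → Prop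
  | of_iso {V E V' E'} {G : Multigraph V E} {H : Multigraph V' E'} :
      Iso G H → IsSubdivisionOf G H
  | step {V E V' E'} {G : Multigraph V E} {H : Multigraph V' E'} (e : E) :
      IsSubdivisionOf G H → IsSubdivisionOf (G.subdivide e) H
  | iso_left {V₁ E₁ V₂ E₂ V' E'} {G₁ : Multigraph V₁ E₁} {G₂ : Multigraph V₂ E₂}
      {H : Multigraph V' E'} :
      Iso G₁ G₂ → IsSubdivisionOf G₂ H → IsSubdivisionOf G₁ H

/-- A multigraph is 3-connected if it has at least 4 vertices and remains connected
after deleting any set of fewer than 3 vertices. -/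
def ThreeConnected (G : Multigraph V E) : Prop :=
  4 ≤ Nat.card V ∧ ∀ S : Set V, S.ncard < 3 → (G.deleteVerts S).Connected

/-- `G` is (isomorphic to) the multigraph `Z_k` with two vertices joined by `k`
parallel edges. -/
def IsZk (G : Multigraph V E) (k : ℕ) : Prop :=
  Nat.card V = 2 ∧ Nat.card E = k ∧ G.Loopless

/-- `G` is essentially 3-connected: a subdivision of a 3-connected graph,
or `Z_k` for some `k ≥ 3`. -/
def EssentiallyThreeConnected (G : Multigraph V E) : Prop :=
  (∃ (V' E' : Type) (H : Multigraph V' E'), H.ThreeConnected ∧ G.IsSubdivisionOf H) ∨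
    ∃ k, 3 ≤ k ∧ G.IsZk k

end Multigraph

section
open Polynomial

theorem an_prod_ge (u : Multiset ℝ) (Q : ℤ[X])
    (h : Q.map (Int.castRingHom ℝ) = (u.map fun a => X - C a).prod) :
    1 ≤ ((u.filter (fun a => a ≠ 0)).map fun a => a ^ 2).prod := by
  classical
  set w := u.filter (fun a => a ≠ 0) with hw
  have hz : u.filter (fun a => ¬ (a ≠ 0)) = Multiset.replicate (u.filter (fun a => ¬ (a ≠ 0))).card 0 := by
    rw [Multiset.eq_replicate_card]
    intro b hb
    simpa using (Multiset.mem_filter.1 hb).2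
  set k := (u.filter (fun a => ¬ (a ≠ 0))).card with hk
  have hu : u = Multiset.replicate k 0 + w := by
    rw [← hz, hw, add_comm, Multiset.filter_add_not]
  have h2 : Q.map (Int.castRingHom ℝ) = X ^ k * (w.map fun a => X - C a).prod := by
    rw [h, hu]; simp
  have h3 : ((Q.coeff k : ℤ) : ℝ) = (w.map fun a => -a).prod := by
    have := congrArg (fun p => p.coeff k) h2
    simp only [coeff_map] at this
    have h4 := coeff_X_pow_mul (w.map fun a => X - C a).prod k 0
    rw [zero_add] at h4
    rw [h4, coeff_zero_eq_eval_zero, eval_multiset_prod] at this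
    simpa using this
  have h5 : (w.map fun a => -a).prod ≠ 0 := by
    apply Multiset.prod_ne_zero
    intro hm
    obtain ⟨a, ha, ha0⟩ := Multiset.mem_map.1 hm
    have := (Multiset.mem_filter.1 ha).2
    apply this; linarith
  have h6 : (w.map fun a => a ^ 2).prod = ((w.map fun a => -a).prod) ^ 2 := by
    rw [← Multiset.prod_map_pow]; simp
  rw [h6, ← h3]
  rw [← h3] at h5
  have h7 : Q.coeff k ≠ 0 := by exact_mod_cast h5
  have : (1 : ℤ) ≤ (Q.coeff k) ^ 2 := by
    have := pow_pos (abs_pos.2 h7) 2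
    rw [sq_abs] at this; omega
  exact_mod_cast this

theorem an_card_le (w : Multiset ℝ) (h : 1 ≤ (w.map fun a => a ^ 2).prod) :
    (w.card : ℝ) ≤ (w.map fun a => a ^ 2).sum := by
  have key : ∀ w : Multiset ℝ, (w.map fun a => a ^ 2).prod ≤
      Real.exp ((w.map fun a => a ^ 2).sum - w.card) := by
    intro w
    induction w using Multiset.induction_on with
    | empty => simp
    | cons a s ih =>
      simp only [Multiset.map_cons, Multiset.prod_cons, Multiset.sum_cons, Multiset.card_cons]
      have h1 : a ^ 2 ≤ Real.exp (a ^ 2 - 1) := by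
        have := Real.add_one_le_exp (a ^ 2 - 1); linarith
      have : a ^ 2 + (s.map fun a => a ^ 2).sum - ((s.card + 1 : ℕ) : ℝ)
        = (a ^ 2 - 1) + ((s.map fun a => a ^ 2).sum - s.card) := by push_cast; ring
      rw [this, Real.exp_add]
      apply mul_le_mul h1 ih _ (Real.exp_pos _).le
      apply Multiset.prod_nonneg
      intro b hb
      obtain ⟨c, _, rfl⟩ := Multiset.mem_map.1 hb
      positivity
  have := h.trans (key w)
  have := Real.one_le_exp_iff.1 this
  linarith

theorem an_sq_expand (w : Multiset ℝ) (c : ℝ) :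
    (w.map fun a => (a - c) ^ 2).sum =
      (w.map fun a => a ^ 2).sum - 2 * c * w.sum + c ^ 2 * w.card := by
  induction w using Multiset.induction_on with
  | empty => simp
  | cons a s ih => simp [ih]; ring

theorem an_sq_nonneg (w : Multiset ℝ) (c : ℝ) :
    0 ≤ (w.map fun a => a ^ 2).sum - 2 * c * w.sum + c ^ 2 * w.card := by
  rw [← an_sq_expand]
  apply Multiset.sum_nonneg
  intro b hb
  obtain ⟨c, _, rfl⟩ := Multiset.mem_map.1 hb
  positivity

theorem an_all_eq (w : Multiset ℝ) (c : ℝ)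
    (h : (w.map fun a => a ^ 2).sum - 2 * c * w.sum + c ^ 2 * w.card ≤ 0) :
    ∀ a ∈ w, a = c := by
  rw [← an_sq_expand] at h
  intro a ha
  have h1 : (a - c) ^ 2 ≤ (w.map fun a => (a - c) ^ 2).sum := by
    apply Multiset.single_le_sum
    · intro b hb
      obtain ⟨c, _, rfl⟩ := Multiset.mem_map.1 hb
      positivity
    · exact Multiset.mem_map_of_mem (fun a => (a - c) ^ 2) ha
  have : (a - c) ^ 2 = 0 := le_antisymm (h1.trans h) (sq_nonneg _)
  nlinarith [pow_eq_zero_iff (two_ne_zero) |>.1 this]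

/-- The numerical heart: `u` is the multiset of shifted roots. -/
theorem an_core (u : Multiset ℝ) (Q : ℤ[X]) (n m t : ℕ)
    (h : Q.map (Int.castRingHom ℝ) = (u.map fun a => X - C a).prod)
    (hn : 2 ≤ n)
    (h0 : (0 : ℝ) ∈ u)
    (hc : u.card + n = m + 1)
    (hs1 : u.sum = (n : ℝ) - 1)
    (hs2 : (u.map fun a => a ^ 2).sum = 2 * (t : ℝ) - n + 1)
    (ht : t ≤ n) (htn : t = n → 2 * m = 3 * n) :
    ∀ a ∈ u, a = 0 ∨ a = 1 ∨ a = 2 := by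
  classical
  have hp := an_card_le _ (an_prod_ge u Q h)
  set w := u.filter (fun a => a ≠ 0) with hw
  have hsplit : u.filter (fun a => a ≠ 0) + u.filter (fun a => ¬ (a ≠ 0)) = u :=
    Multiset.filter_add_not _ _
  set z := u.filter (fun a => ¬ (a ≠ 0)) with hz
  have hzr : z = Multiset.replicate z.card 0 := by
    rw [Multiset.eq_replicate_card]
    intro b hb
    simpa using (Multiset.mem_filter.1 hb).2
  have hzc : 1 ≤ z.card := by
    rw [Nat.one_le_iff_ne_zero, Ne, Multiset.card_eq_zero]
    intro h
    have : (0 : ℝ) ∈ z := Multiset.mem_filter.2 ⟨h0, by simp⟩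
    rw [h] at this; simp at this
  have hwu : w + z = u := hsplit
  have hws : w.sum = (n : ℝ) - 1 := by
    rw [← hs1, ← hwu, Multiset.sum_add, hzr]; simp
  have hws2 : (w.map fun a => a ^ 2).sum = 2 * (t : ℝ) - n + 1 := by
    rw [← hs2, ← hwu, Multiset.map_add, Multiset.sum_add, hzr]; simp
  have hwc : w.card + n ≤ m := by
    have : w.card + z.card = u.card := by rw [← hwu, Multiset.card_add]
    omega
  suffices hall : ∀ a ∈ w, a = 1 ∨ a = 2 by
    intro a ha
    by_cases h : a = 0
    · exact Or.inl h
    · exact Or.inr (hall a (Multiset.mem_filter.2 ⟨ha, h⟩))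
  have hex := an_sq_nonneg w
  have hae := an_all_eq w
  rw [hws2, hws] at hex hae
  rw [hws2] at hp
  have hn' : (2 : ℝ) ≤ n := by exact_mod_cast hn
  set N : ℝ := (w.card : ℝ) with hN
  have hNN : 0 ≤ N := by positivity
  -- t ≥ n - 1
  have ht1 : n ≤ t + 1 := by
    by_contra hlt
    have : (t : ℝ) + 2 ≤ n := by exact_mod_cast (by omega : t + 2 ≤ n)
    have h1 := hex 1
    nlinarith
  rcases (by omega : t + 1 = n ∨ t = n) with ht2 | ht2
  · have ht3 : (t : ℝ) = n - 1 := by rw [← ht2]; push_cast; ring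
    intro a ha
    left
    apply hae 1 _ a ha
    rw [ht3] at hp ⊢
    nlinarith
  · have hm := htn ht2
    have hN2 : 2 * w.card ≤ n := by omega
    have h1 := hex 1
    rw [ht2] at h1 hp hae
    have h2 : n ≤ w.card + 3 := by
      have : (n : ℝ) ≤ N + 3 := by linarith
      rw [hN] at this
      exact_mod_cast this
    rcases (by omega : n = w.card + 3 ∨ n = w.card + 2 ∨ n = w.card + 1) with h3 | h3 | h3
    · intro a ha
      left
      apply hae 1 _ a ha
      have : (n : ℝ) = N + 3 := by rw [h3]; push_cast; rfl
      nlinarith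
    · have hle : w.card ≤ 2 := by omega
      have h3' : (n : ℝ) = N + 2 := by rw [h3]; push_cast; rfl
      rcases (by omega : w.card = 0 ∨ w.card = 1 ∨ w.card = 2) with h4 | h4 | h4
      · rw [Multiset.card_eq_zero] at h4; rw [h4]; simp
      · obtain ⟨b, hb⟩ := Multiset.card_eq_one.1 h4
        rw [hb] at hws
        have : N = 1 := by rw [hN, h4]; simp
        simp at hws
        rw [hb]; intro a ha; right
        rw [Multiset.mem_singleton] at ha
        linarith
      · obtain ⟨b, c, hb⟩ := Multiset.card_eq_two.1 h4
        have hNv : N = 2 := by rw [hN, h4]; simp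
        rw [hb] at hws hws2
        simp at hws hws2
        rw [ht2] at hws2
        have e1 : b + c = 3 := by linarith
        have e2 : b ^ 2 + c ^ 2 = 5 := by linarith
        have e3 : (b - 1) * (b - 2) = 0 := by
          have : c = 3 - b := by linarith
          subst this; nlinarith
        rcases mul_eq_zero.1 e3 with e | e
        · rw [hb]; intro a ha
          simp at ha
          rcases ha with rfl | rfl
          · left; linarith
          · right; linarith
        · rw [hb]; intro a ha
          simp at ha
          rcases ha with rfl | rfl
          · right; linarith
          · left; linarith
    · exfalso
      have hle : w.card = 1 := by omega
      have hNv : N = 1 := by rw [hN, hle]; simp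
      obtain ⟨b, hb⟩ := Multiset.card_eq_one.1 hle
      rw [hb] at hws hws2
      simp at hws hws2
      rw [ht2] at hws2
      have : (n : ℝ) = 2 := by rw [h3, hle]; norm_num
      rw [this] at hws hws2
      have : b = 1 := by linarith
      rw [this] at hws2; norm_num at hws2

theorem an_vieta (s : Multiset ℝ) :
    (s.map fun a => X - C a).prod.coeff s.card = 1 ∧
    (∀ k, s.card = k + 1 → (s.map fun a => X - C a).prod.coeff k = - s.sum) ∧
    (∀ k, s.card = k + 2 → 2 * (s.map fun a => X - C a).prod.coeff k
       = s.sum ^ 2 - (s.map fun a => a ^ 2).sum) := by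
  induction s using Multiset.induction_on with
  | empty => simp
  | cons a s ih =>
    obtain ⟨i1, i2, i3⟩ := ih
    have hdeg : (s.map fun a => X - C a).prod.coeff (s.card + 1) = 0 := by
      apply coeff_eq_zero_of_natDegree_lt
      rw [natDegree_multiset_prod_X_sub_C_eq_card]; omega
    simp only [Multiset.map_cons, Multiset.prod_cons, Multiset.sum_cons, Multiset.card_cons]
    refine ⟨?_, ?_, ?_⟩
    · rw [sub_mul, coeff_sub, coeff_X_mul, coeff_C_mul, hdeg, i1]; ring
    · intro k hk
      obtain rfl : s.card = k := by omega
      rcases Nat.eq_zero_or_pos s.card with h | h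
      · rw [Multiset.card_eq_zero] at h; subst h; simp
      · obtain ⟨j, hj⟩ : ∃ j, s.card = j + 1 := ⟨s.card - 1, by omega⟩
        have e := i2 j hj
        rw [sub_mul, coeff_sub, coeff_C_mul, i1, hj, coeff_X_mul, e]; ring
    · intro k hk
      have hk' : s.card = k + 1 := by omega
      have e := i2 k hk'
      rcases Nat.eq_zero_or_pos k with h | h
      · subst h
        obtain ⟨b, hb⟩ := Multiset.card_eq_one.1 hk'
        subst hb; simp; ring
      · obtain ⟨j, rfl⟩ : ∃ j, k = j + 1 := ⟨k - 1, by omega⟩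
        have e' := i3 j (by omega)
        rw [sub_mul, coeff_sub, coeff_C_mul, coeff_X_mul, e, mul_sub, e']; ring

/-- A real-rooted integer polynomial with the prescribed top coefficients has
all its roots in `{1,2,3}`. -/
theorem an_main (F : ℝ[X]) (Q : ℤ[X]) (n m t r : ℕ) (hQ : Q.map (Int.castRingHom ℝ) = F)
    (hn : 2 ≤ n) (hr : r + 2 + n = m + 1)
    (hdeg : F.natDegree ≤ r + 2) (hc0 : F.coeff (r + 2) = 1)
    (hc1 : F.coeff (r + 1) = - (m : ℝ)) (hc2 : 2 * F.coeff r = (m : ℝ) * (m - 1) - 2 * t)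
    (h1 : F.eval 1 = 0) (ht : t ≤ n) (htn : t = n → 2 * m = 3 * n)
    (hreal : ∀ z : ℂ, aeval z F = 0 → z.im = 0) :
    ∀ z : ℂ, aeval z F = 0 → z = 1 ∨ z = 2 ∨ z = 3 := by
  have hF0 : F ≠ 0 := by rintro rfl; simp at hc0
  have hnd : F.natDegree = r + 2 := le_antisymm hdeg (le_natDegree_of_ne_zero (by rw [hc0]; simp))
  have hmon : F.Monic := by rw [Monic, leadingCoeff, hnd, hc0]
  have hsp : F.Splits := by
    have hsC : (F.map (algebraMap ℝ ℂ)).Splits := IsAlgClosed.splits _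
    apply Splits.of_splits_map_of_injective (algebraMap ℝ ℂ).injective hsC
    intro z hz
    have : aeval z F = 0 := by
      have := (mem_roots'.1 hz).2
      rwa [IsRoot.def, eval_map_algebraMap] at this
    exact ⟨z.re, by apply Complex.ext <;> simp [hreal z this]⟩
  have hprod : F = (F.roots.map fun a => X - C a).prod := hsp.eq_prod_roots_of_monic hmon
  have hcard : F.roots.card = r + 2 := by rw [← hnd]; exact hsp.natDegree_eq_card_roots.symm
  obtain ⟨v0, v1, v2⟩ := an_vieta F.roots
  rw [← hprod] at v0 v1 v2
  have w1 := v1 (r + 1) hcard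
  have w2 := v2 r hcard
  rw [hc1] at w1
  rw [hc2] at w2
  have hsum : F.roots.sum = m := by linarith
  rw [hsum] at w2
  have key := an_core (F.roots.map fun a => a - 1) (Q.comp (X + 1)) n m t
    (by
      rw [Polynomial.map_comp, hQ, hprod, multiset_prod_comp]
      simp only [Multiset.map_map, Function.comp_def]
      rw [← hprod]
      congr 1
      apply Multiset.map_congr rfl
      intro a _
      simp
      ring) hn
    (Multiset.mem_map.2 ⟨1, (mem_roots hF0).2 h1, by simp⟩)
    (by rw [Multiset.card_map, hcard]; omega)
    (by
      rw [Multiset.sum_map_sub, Multiset.map_id', hsum]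
      simp [hcard]
      have : ((r + 2 + n : ℕ) : ℝ) = (m + 1 : ℕ) := by rw [hr]
      push_cast at this
      linarith)
    (by
      rw [Multiset.map_map]
      simp only [Function.comp_def]
      rw [an_sq_expand, hsum, hcard]
      have : ((r + 2 + n : ℕ) : ℝ) = (m + 1 : ℕ) := by rw [hr]
      push_cast at this ⊢
      linarith) ht htn
  intro z hz
  have him := hreal z hz
  have hzr : z = ((z.re : ℝ) : ℂ) := by apply Complex.ext <;> simp [him]
  have hroot : z.re ∈ F.roots := by
    rw [mem_roots hF0, IsRoot.def]
    rw [hzr] at hz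
    have h2 : aeval ((z.re : ℝ) : ℂ) F = ((F.eval z.re : ℝ) : ℂ) := by
      have := aeval_algebraMap_apply ℂ z.re F
      simpa using this
    rw [h2] at hz
    exact_mod_cast hz
  have hk := key (z.re - 1) (Multiset.mem_map.2 ⟨z.re, hroot, rfl⟩)
  rw [hzr]
  rcases hk with h | h | h
  · left; rw [show z.re = 1 by linarith]; simp
  · right; left; rw [show z.re = 2 by linarith]; simp
  · right; right; rw [show z.re = 3 by linarith]; simp

end

section
open Polynomial

namespace FlowAux
open Multigraph

variable {V E K : Type}

/-- The coboundary of `g`. -/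
def dd [Sub K] (G : Multigraph V E) (g : V → K) (e : E) : K := g (G.snd e) - g (G.fst e)

theorem card_sub_eq {α : Type} [Fintype α] (p : α → Prop) [DecidablePred p] :
    (Nat.card {a // p a} : ℤ) = ∑ a, if p a then 1 else 0 := by
  rw [Nat.card_eq_fintype_card, Fintype.card_subtype, Finset.card_filter]
  push_cast; rfl

theorem incl_excl [Fintype E] [Fintype K] [Zero K] (P : Finset E) (T : (E → K) → Prop) :
    (Nat.card {φ : E → K // (∀ e, φ e ≠ 0 ↔ e ∈ P) ∧ T φ} : ℤ) =
      ∑ A ∈ P.powerset, (-1 : ℤ) ^ (P.card - A.card) *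
        Nat.card {φ : E → K // (∀ e, φ e ≠ 0 → e ∈ A) ∧ T φ} := by
  classical
  simp only [card_sub_eq, Finset.mul_sum]
  rw [Finset.sum_comm]
  apply Finset.sum_congr rfl
  intro φ _
  by_cases hT : T φ
  swap
  · simp [hT]
  simp only [hT, and_true]
  by_cases hsup : ∀ e, φ e ≠ 0 → e ∈ P
  · have h1 : ∏ e ∈ P, ((1 : ℤ) + (if φ e = 0 then -1 else 0)) =
        if (∀ e, φ e ≠ 0 ↔ e ∈ P) then 1 else 0 := by
      split_ifs with h
      · apply Finset.prod_eq_one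
        intro e he
        simp [(h e).2 he]
      · have : ∃ e ∈ P, φ e = 0 := by
          by_contra hcon
          push Not at hcon
          exact h fun e => ⟨hsup e, hcon e⟩
        obtain ⟨e, he, h0⟩ := this
        apply Finset.prod_eq_zero he
        simp [h0]
    rw [← h1, Finset.prod_add]
    apply Finset.sum_congr rfl
    intro A hA
    have hAP := Finset.mem_powerset.1 hA
    rw [Finset.prod_const_one, one_mul]
    split_ifs with h
    · rw [Finset.prod_congr rfl (g := fun _ => (-1 : ℤ)), Finset.prod_const,
        Finset.card_sdiff_of_subset hAP, mul_one]
      intro e he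
      have : φ e = 0 := by
        by_contra h0
        exact (Finset.mem_sdiff.1 he).2 (h e h0)
      simp [this]
    · push Not at h
      obtain ⟨e, h0, heA⟩ := h
      rw [mul_zero]
      apply Finset.prod_eq_zero (Finset.mem_sdiff.2 ⟨hsup e h0, heA⟩)
      simp [h0]
  · have : ¬ (∀ e, φ e ≠ 0 ↔ e ∈ P) := fun h => hsup fun e => (h e).1
    rw [if_neg this]
    symm
    apply Finset.sum_eq_zero
    intro A hA
    rw [if_neg, mul_zero]
    intro h
    exact hsup fun e he => Finset.mem_powerset.1 hA (h e he)

theorem card_eq_of_sub [Fintype E] [Fintype K] [Zero K] (P : Finset E) (T T' : (E → K) → Prop)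
    (h : ∀ A ⊆ P, Nat.card {φ : E → K // (∀ e, φ e ≠ 0 → e ∈ A) ∧ T φ} =
      Nat.card {φ : E → K // (∀ e, φ e ≠ 0 → e ∈ A) ∧ T' φ}) :
    Nat.card {φ : E → K // (∀ e, φ e ≠ 0 ↔ e ∈ P) ∧ T φ} =
      Nat.card {φ : E → K // (∀ e, φ e ≠ 0 ↔ e ∈ P) ∧ T' φ} := by
  have : (Nat.card {φ : E → K // (∀ e, φ e ≠ 0 ↔ e ∈ P) ∧ T φ} : ℤ) =
      Nat.card {φ : E → K // (∀ e, φ e ≠ 0 ↔ e ∈ P) ∧ T' φ} := by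
    rw [incl_excl, incl_excl]
    apply Finset.sum_congr rfl
    intro A hA
    rw [h A (Finset.mem_powerset.1 hA)]
  exact_mod_cast this

/-- Functions killed by the coboundary on `A` are the functions on the components. -/
theorem ker_equiv [Field K] [Fintype V] (G : Multigraph V E) (A : Set E) :
    Nonempty ((Quotient (G.reachSetoid A) → K) ≃ₗ[K]
      (LinearMap.ker (LinearMap.pi (fun e : A => (LinearMap.proj (R := K) (φ := fun _ : V => K) (G.snd e.1)
        - LinearMap.proj (G.fst e.1)))))) := by
  refine ⟨LinearEquiv.ofBijective
    ((LinearMap.funLeft K K (Quotient.mk (G.reachSetoid A))).codRestrict _ ?_) ⟨?_, ?_⟩⟩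
  · intro g
    rw [LinearMap.mem_ker]
    ext e
    simp only [LinearMap.pi_apply, LinearMap.sub_apply, LinearMap.proj_apply, LinearMap.funLeft_apply,
      Pi.zero_apply]
    rw [sub_eq_zero]
    congr 1
    apply Quotient.sound
    exact Relation.EqvGen.rel _ _ ⟨e.1, e.2, Or.inr ⟨rfl, rfl⟩⟩
  · intro g h hgh
    have := congrArg Subtype.val hgh
    funext q
    induction q using Quotient.inductionOn with
    | h v => exact congrFun this v
  · rintro ⟨g, hg⟩
    rw [LinearMap.mem_ker] at hg
    have hrel : ∀ a b, Relation.EqvGen (G.edgeRelOn A) a b → g a = g b := by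
      intro a b hab
      induction hab with
      | rel a b h =>
        obtain ⟨e, he, h⟩ := h
        have := congrFun hg ⟨e, he⟩
        simp only [LinearMap.pi_apply, LinearMap.sub_apply, LinearMap.proj_apply, Pi.zero_apply,
          sub_eq_zero] at this
        rcases h with ⟨rfl, rfl⟩ | ⟨rfl, rfl⟩
        · exact this.symm
        · exact this
      | refl a => rfl
      | symm a b _ ih => exact ih.symm
      | trans a b c _ _ h1 h2 => exact h1.trans h2
    refine ⟨fun q => Quotient.lift g hrel q, ?_⟩
    apply Subtype.ext
    funext v
    rfl

theorem finrank_flow [Field K] [Fintype V] [Fintype E] (G : Multigraph V E) (A : Finset E) :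
    ∃ W : Submodule K (A → K), Module.finrank K W + Fintype.card V = A.card + G.ncomp ↑A ∧
      ∀ φ : A → K, φ ∈ W ↔ ∀ g : V → K, ∑ e : A, φ e * dd G g e.1 = 0 := by
  classical
  let L : (V → K) →ₗ[K] (A → K) := LinearMap.pi (fun e : A =>
    (LinearMap.proj (R := K) (φ := fun _ : V => K) (G.snd e.1) - LinearMap.proj (G.fst e.1)))
  have hL : ∀ g e, L g e = dd G g e.1 := fun g e => rfl
  let M := LinearMap.toMatrix' L
  have hM : ∀ g, M.mulVec g = L g := fun g => LinearMap.toMatrix'_mulVec L g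
  refine ⟨LinearMap.ker (M.transpose.mulVecLin), ?_, ?_⟩
  · have h1 := LinearMap.finrank_range_add_finrank_ker (M.transpose.mulVecLin)
    have h2 := LinearMap.finrank_range_add_finrank_ker L
    have h3 : Module.finrank K (LinearMap.range (M.transpose.mulVecLin)) =
        Module.finrank K (LinearMap.range L) := by
      have := Matrix.rank_transpose M
      rw [Matrix.rank, Matrix.rank] at this
      rw [this]
      have h9 : M.mulVecLin = L := by
        apply LinearMap.ext
        intro g
        rw [Matrix.mulVecLin_apply, hM]
      rw [h9]
    have h4 : Module.finrank K (LinearMap.ker L) = G.ncomp ↑A := by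
      obtain ⟨eq⟩ := ker_equiv (K := K) G (↑A : Set E)
      have h8 := eq.finrank_eq
      have : Fintype (Quotient (G.reachSetoid (↑A : Set E))) := Fintype.ofFinite _
      rw [Module.finrank_fintype_fun_eq_card] at h8
      rw [Multigraph.ncomp, Nat.card_eq_fintype_card, h8]
      rfl
    rw [Module.finrank_fintype_fun_eq_card] at h1 h2
    rw [Fintype.card_coe] at h1
    omega
  · intro φ
    rw [LinearMap.mem_ker, Matrix.mulVecLin_apply, Matrix.mulVec_transpose]
    have key : ∀ g : V → K, ∑ e : A, φ e * dd G g e.1 = dotProduct (Matrix.vecMul φ M) g := by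
      intro g
      rw [← Matrix.dotProduct_mulVec, hM]
      rfl
    simp only [key]
    constructor
    · intro h g; rw [h]; simp
    · intro h
      exact dotProduct_eq_zero _ h

/-- Support conditions: functions on `A` extended by zero. -/
noncomputable def extEquiv [Fintype E] [Zero K] (A : Finset E) :
    {φ : E → K // ∀ e, φ e ≠ 0 → e ∈ A} ≃ (A → K) := by
  classical
  exact
  { toFun := fun φ e => φ.1 e.1
    invFun := fun ψ => ⟨fun e => if h : e ∈ A then ψ ⟨e, h⟩ else 0, fun e he => by
      by_contra h; simp [h] at he⟩
    left_inv := fun φ => by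
      apply Subtype.ext
      funext e
      by_cases h : e ∈ A
      · simp [h]
      · have := φ.2 e
        simp only [h, imp_false, not_not] at this
        simp [h, this]
    right_inv := fun ψ => by
      funext e
      simp }

theorem card_flow_sub [Field K] [Fintype K] [Fintype V] [Fintype E] (G : Multigraph V E)
    (A : Finset E) :
    Fintype.card V ≤ A.card + G.ncomp ↑A ∧
    Nat.card {φ : E → K // (∀ e, φ e ≠ 0 → e ∈ A) ∧ ∀ g : V → K, ∑ e, φ e * dd G g e = 0} =
      Fintype.card K ^ (A.card + G.ncomp ↑A - Fintype.card V) := by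
  classical
  obtain ⟨W, h1, h2⟩ := finrank_flow (K := K) G A
  refine ⟨by omega, ?_⟩
  have h3 : A.card + G.ncomp ↑A - Fintype.card V = Module.finrank K W := by omega
  rw [h3]
  have h4 : Nat.card W = Fintype.card K ^ Module.finrank K W := by
    have : Fintype W := Fintype.ofFinite _
    rw [Nat.card_eq_fintype_card, Module.card_eq_pow_finrank (K := K)]
  rw [← h4]
  apply Nat.card_congr
  refine (Equiv.subtypeSubtypeEquivSubtypeInter _ _).symm.trans ?_
  apply (extEquiv (K := K) A).subtypeEquiv
  rintro ⟨φ, hφ⟩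
  rw [h2]
  apply forall_congr'
  intro g
  have : ∑ e, φ e * dd G g e = ∑ e : A, (extEquiv (K := K) A ⟨φ, hφ⟩) e * dd G g e.1 := by
    have h5 : ∀ e : A, (extEquiv (K := K) A ⟨φ, hφ⟩) e = φ e.1 := fun e => rfl
    simp only [h5]
    rw [Finset.sum_coe_sort A (fun e => φ e * dd G g e)]
    symm
    apply Finset.sum_subset (Finset.subset_univ _)
    intro e _ he
    have : φ e = 0 := by by_contra h; exact he (hφ e h)
    simp [this]
  rw [this]

/-- Number of nowhere-zero (on exactly `S`) solutions tested against functions in `L`. -/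
noncomputable def cnt [Field K] [Fintype E] (G : Multigraph V E) (S : Set E)
    (L : Set (V → K)) : ℕ :=
  Nat.card {φ : E → K // (∀ e, φ e ≠ 0 ↔ e ∈ S) ∧ ∀ g ∈ L, ∑ e, φ e * dd G g e = 0}

theorem flowPoly_eq [Fintype V] [Fintype E] (G : Multigraph V E) :
    G.flowPoly = ∑ E' : Finset E, (-1 : ℝ[X]) ^ (Fintype.card E - E'.card) *
      X ^ (E'.card + G.ncomp ↑E' - Fintype.card V) := by
  unfold Multigraph.flowPoly
  simp only [Nat.card_eq_fintype_card]
  congr!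

theorem eval_flow [Fintype V] [Fintype E] (G : Multigraph V E) (p : ℕ) [Fact p.Prime] :
    G.flowPoly.eval (p : ℝ) = cnt G Set.univ (Set.univ : Set (V → ZMod p)) := by
  classical
  have h := incl_excl (K := ZMod p) (Finset.univ : Finset E)
    (fun φ => ∀ g : V → ZMod p, ∑ e, φ e * dd G g e = 0)
  have h2 : (cnt G Set.univ (Set.univ : Set (V → ZMod p)) : ℤ) = ∑ A : Finset E,
      (-1 : ℤ) ^ (Fintype.card E - A.card) * (p : ℤ) ^ (A.card + G.ncomp ↑A - Fintype.card V) := by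
    have h3 : (cnt G Set.univ (Set.univ : Set (V → ZMod p)) : ℤ) =
      (Nat.card {φ : E → ZMod p // (∀ e, φ e ≠ 0 ↔ e ∈ (Finset.univ : Finset E)) ∧
        ∀ g : V → ZMod p, ∑ e, φ e * dd G g e = 0} : ℤ) := by
      unfold cnt
      simp
    rw [h3, h, Finset.powerset_univ]
    apply Finset.sum_congr rfl
    intro A _
    rw [(card_flow_sub G A).2, ZMod.card, Finset.card_univ]
    push_cast; rfl
  have h4 : ((cnt G Set.univ (Set.univ : Set (V → ZMod p)) : ℤ) : ℝ) = _ := congrArg _ h2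
  rw [Int.cast_natCast] at h4
  rw [h4, flowPoly_eq, eval_finsetSum]
  push_cast
  simp

theorem poly_ext (F Q : ℝ[X]) (h : ∀ p : ℕ, p.Prime → F.eval (p : ℝ) = Q.eval (p : ℝ)) : F = Q := by
  apply Polynomial.eq_of_infinite_eval_eq
  apply (Nat.infinite_setOfPred_prime.image (f := fun p : ℕ => (p : ℝ)) (Nat.cast_injective.injOn)).mono
  rintro _ ⟨p, hp, rfl⟩
  exact h p hp

/-- Map the vertices by `f` and keep only the edges in `S`. -/
def mp (G : Multigraph V E) (f : V → V) (S : Set E) : Multigraph (Set.range f) S where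
  fst := fun e => ⟨f (G.fst e.1), Set.mem_range_self _⟩
  snd := fun e => ⟨f (G.snd e.1), Set.mem_range_self _⟩

theorem sum_sub_set [AddCommMonoid K] [Fintype E] (S : Set E) [Fintype S] (h : E → K)
    (h0 : ∀ e, e ∉ S → h e = 0) : ∑ e : S, h e.1 = ∑ e, h e := by
  classical
  rw [Finset.sum_set_coe S (f := h)]
  apply Finset.sum_subset (Finset.subset_univ _)
  intro e _ he
  exact h0 e (by simpa using he)

theorem cnt_mp [Field K] [Fintype E] (G : Multigraph V E) (f : V → V) (S : Set E) [Fintype S] :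
    cnt (mp G f S) Set.univ (Set.univ : Set (Set.range f → K)) =
      cnt G S {h : V → K | ∃ g : V → K, h = g ∘ f} := by
  classical
  unfold cnt
  refine Nat.card_congr (Equiv.symm ?_)
  let A : Finset E := S.toFinset
  refine
  { toFun := fun φ => ⟨fun e => φ.1 e.1, ?_, ?_⟩
    invFun := fun ψ => ⟨fun e => if h : e ∈ S then ψ.1 ⟨e, h⟩ else 0, ?_, ?_⟩
    left_inv := ?_
    right_inv := ?_ }
  · intro e; simp [φ.2.1]
  · intro g _
    obtain ⟨φ, h1, h2⟩ := φ
    have := h2 ((fun v => if h : v ∈ Set.range f then g ⟨v, h⟩ else 0) ∘ f) ⟨_, rfl⟩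
    refine Eq.trans ?_ this
    have e1 : ∀ v, (fun v => if h : v ∈ Set.range f then g ⟨v, h⟩ else 0) (f v) =
      g ⟨f v, Set.mem_range_self _⟩ := fun v => by simp
    have e2 : ∀ e : S, φ e.1 * dd (mp G f S) g e = (fun e => φ e * dd G ((fun v => if h : v ∈ Set.range f then g ⟨v, h⟩ else 0) ∘ f) e) e.1 := by
      intro e
      simp only [dd, Function.comp, mp, e1]
    refine (Finset.sum_congr rfl fun e _ => e2 e).trans (sum_sub_set S (fun e => φ e * dd G ((fun v => if h : v ∈ Set.range f then g ⟨v, h⟩ else 0) ∘ f) e) ?_)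
    intro e he
    have : φ e = 0 := by
      by_contra h; exact he ((h1 e).1 h)
    simp [this]
  · intro e
    by_cases h : e ∈ S
    · simp [h, (ψ.2.1 ⟨e, h⟩).2]
    · simp [h]
  · rintro _ ⟨g, rfl⟩
    obtain ⟨ψ, h1, h2⟩ := ψ
    refine Eq.trans ?_ (h2 (fun v => g v.1) trivial)
    have e2 : ∀ e : S, ψ e * dd (mp G f S) (fun v => g v.1) e = (fun e => (if h : e ∈ S then ψ ⟨e, h⟩ else 0) * dd G (g ∘ f) e) e.1 := by
      intro e
      simp only [dd, Function.comp, mp]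
      simp
    refine Eq.symm ((Finset.sum_congr rfl fun e _ => e2 e).trans (sum_sub_set S (fun e => (if h : e ∈ S then ψ ⟨e, h⟩ else 0) * dd G (g ∘ f) e) ?_))
    intro e he
    simp [he]
  · intro φ
    apply Subtype.ext
    funext e
    by_cases h : e ∈ S
    · simp [h]
    · have := φ.2.1 e
      simp only [h, iff_false, not_not] at this
      simp [h, this]
  · intro ψ
    apply Subtype.ext
    funext e
    simp

end FlowAux

end

section
open Polynomial

namespace FlowAux
open Multigraph

variable {V E K : Type}

open Classical in
/-- The edge cut of `X`. -/
noncomputable def cut [Fintype E] (G : Multigraph V E) (X : Set V) : Finset E :=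
  Finset.univ.filter fun e => ¬ (G.fst e ∈ X ↔ G.snd e ∈ X)

theorem mem_cut [Fintype E] (G : Multigraph V E) (X : Set V) (e : E) :
    e ∈ cut G X ↔ ¬ (G.fst e ∈ X ↔ G.snd e ∈ X) := by
  simp [cut]

theorem cut_compl [Fintype E] (G : Multigraph V E) (X : Set V) : cut G Xᶜ = cut G X := by
  ext e
  simp only [mem_cut, Set.mem_compl_iff]
  tauto

open Classical in
/-- The indicator function of `X`. -/
noncomputable def ind (K : Type) [Zero K] [One K] (X : Set V) (v : V) : K :=
  if v ∈ X then 1 else 0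

theorem dd_ind_not [Field K] [Fintype E] (G : Multigraph V E) (X : Set V) (e : E)
    (h : e ∉ cut G X) : dd G (ind K X) e = 0 := by
  rw [mem_cut, not_not] at h
  by_cases h1 : G.snd e ∈ X <;> simp [dd, ind, h, h1]

theorem dd_ind_sq [Field K] [Fintype E] (G : Multigraph V E) (X : Set V) (e : E)
    (h : e ∈ cut G X) : dd G (ind K X) e * dd G (ind K X) e = 1 := by
  rw [mem_cut] at h
  by_cases h1 : G.fst e ∈ X <;> by_cases h2 : G.snd e ∈ X <;> simp_all [dd, ind]

theorem dd_ind_ne [Field K] [Fintype E] (G : Multigraph V E) (X : Set V) (e : E)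
    (h : e ∈ cut G X) : dd G (ind K X) e ≠ 0 := by
  intro h0
  have := dd_ind_sq (K := K) G X e h
  rw [h0] at this; simp at this

theorem sum_ind [Field K] [Fintype E] (G : Multigraph V E) (X : Set V) (φ : E → K) :
    ∑ e, φ e * dd G (ind K X) e = ∑ e ∈ cut G X, φ e * dd G (ind K X) e := by
  symm
  apply Finset.sum_subset (Finset.subset_univ _)
  intro e _ he
  rw [dd_ind_not G X e he, mul_zero]

theorem dd_decomp [Field K] (G : Multigraph V E) (X : Set V) (g : V → K) (c : K) (e : E) :
    dd G g e = dd G (fun v => g v + c * ind K X v) e - c * dd G (ind K X) e := by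
  simp only [dd]; ring

theorem sum_decomp [Field K] [Fintype E] (G : Multigraph V E) (X : Set V) (g : V → K) (c : K)
    (φ : E → K) :
    ∑ e, φ e * dd G g e = ∑ e, φ e * dd G (fun v => g v + c * ind K X v) e
      - c * ∑ e, φ e * dd G (ind K X) e := by
  rw [Finset.mul_sum, ← Finset.sum_sub_distrib]
  apply Finset.sum_congr rfl
  intro e _
  rw [dd_decomp G X g c e]; ring

theorem cnt_cut1 [Field K] [Fintype E] (G : Multigraph V E) (X : Set V)
    (h : (cut G X).card = 1) : cnt G Set.univ (Set.univ : Set (V → K)) = 0 := by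
  obtain ⟨e, he⟩ := Finset.card_eq_one.1 h
  unfold cnt
  rw [Nat.card_eq_zero]
  left
  constructor
  rintro ⟨φ, h1, h2⟩
  have := h2 (ind K X) trivial
  rw [sum_ind, he, Finset.sum_singleton] at this
  rcases mul_eq_zero.1 this with h3 | h3
  · exact (h1 e).2 trivial h3
  · exact dd_ind_ne (K := K) G X e (by simp [he]) h3

open Classical in
/-- Identify `v` with `u`. -/
noncomputable def idf (u v : V) (w : V) : V := if w = v then u else w

theorem idf_test [Field K] (X : Set V) (u v : V) (hu : u ∈ X) (hv : v ∉ X) (g : V → K) :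
    (fun w => g w + (g v - g u) * ind K X w) =
      (fun w => g w + (g v - g u) * ind K X w) ∘ idf u v := by
  funext w
  by_cases h : w = v
  · subst h
    simp [idf, ind, hu, hv]
  · simp [idf, h]

theorem cnt_cut0 [Field K] [Fintype E] (G : Multigraph V E) (X : Set V) (u v : V)
    (hu : u ∈ X) (hv : v ∉ X) (h : cut G X = ∅) :
    cnt G Set.univ (Set.univ : Set (V → K)) =
      cnt G Set.univ {h : V → K | ∃ g : V → K, h = g ∘ idf u v} := by
  unfold cnt
  apply Nat.card_congr
  apply Equiv.subtypeEquivRight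
  intro φ
  apply and_congr_right
  intro _
  constructor
  · intro h g _; exact h g trivial
  · intro h2 g _
    rw [sum_decomp G X g (g v - g u), sum_ind G X, h, Finset.sum_empty, mul_zero, sub_zero]
    exact h2 _ ⟨_, idf_test X u v hu hv g⟩

theorem cnt_cut2 [Field K] [Fintype E] (G : Multigraph V E) (X : Set V) (u v : V)
    (hu : u ∈ X) (hv : v ∉ X) (e f : E) (hef : e ≠ f) (h : ∀ x, x ∈ cut G X ↔ x = e ∨ x = f)
    (huv : (G.fst e = u ∧ G.snd e = v) ∨ (G.fst e = v ∧ G.snd e = u)) :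
    cnt G Set.univ (Set.univ : Set (V → K)) =
      cnt G {x | x ≠ e} {h : V → K | ∃ g : V → K, h = g ∘ idf u v} := by
  classical
  have hcut : cut G X = {e, f} := by ext x; simp [h]
  have hsum : ∀ φ : E → K, ∑ x, φ x * dd G (ind K X) x =
      φ e * dd G (ind K X) e + φ f * dd G (ind K X) f := by
    intro φ
    rw [sum_ind, hcut, Finset.sum_pair hef]
  have hde : ∀ g : V → K, dd G (g ∘ idf u v) e = 0 := by
    intro g
    have hne : u ≠ v := by rintro rfl; exact hv hu
    rcases huv with ⟨h1, h2⟩ | ⟨h1, h2⟩ <;> simp [dd, h1, h2, idf]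
  have hupd : ∀ (φ : E → K) (c : K) (g : V → K), dd G g e = 0 →
      ∑ x, Function.update φ e c x * dd G g x = ∑ x, φ x * dd G g x := by
    intro φ c g hg
    apply Finset.sum_congr rfl
    intro x _
    by_cases hx : x = e
    · subst hx; simp [hg]
    · simp [hx]
  have he : e ∈ cut G X := (h e).2 (Or.inl rfl)
  have hf : f ∈ cut G X := (h f).2 (Or.inr rfl)
  have se := dd_ind_sq (K := K) G X e he
  have sf := dd_ind_sq (K := K) G X f hf
  have ne := dd_ind_ne (K := K) G X e he
  have nf := dd_ind_ne (K := K) G X f hf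
  set a := dd G (ind K X) e
  set b := dd G (ind K X) f
  unfold cnt
  refine Nat.card_congr
      { toFun := fun φ => ⟨Function.update φ.1 e 0, ?_, ?_⟩
        invFun := fun φ => ⟨Function.update φ.1 e (- a * b * φ.1 f), ?_, ?_⟩
        left_inv := ?_
        right_inv := ?_ }
  · intro x
    by_cases hx : x = e
    · subst hx; simp
    · have := φ.2.1 x
      simp [hx] at this ⊢
      exact this
  · rintro _ ⟨g, rfl⟩
    rw [hupd _ _ _ (hde g)]
    exact φ.2.2 _ trivial
  · intro x
    by_cases hx : x = e
    · subst hx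
      have := (φ.2.1 f).2 hef.symm
      simp [ne, nf, this]
    · have := φ.2.1 x
      simp [hx] at this ⊢
      exact this
  · intro g _
    have hh := idf_test X u v hu hv g
    rw [sum_decomp G X g (g v - g u), hsum]
    rw [hupd _ _ _ (by rw [hh]; exact hde _), φ.2.2 _ ⟨_, hh⟩]
    simp [hef.symm]
    right
    linear_combination (- b * φ.1 f) * se
  · rintro ⟨φ, h1, h2⟩
    apply Subtype.ext
    funext x
    by_cases hx : x = e
    · subst hx
      have := h2 (ind K X) trivial
      rw [hsum] at this
      simp [hef.symm]
      linear_combination (- a) * this + (φ x) * se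
    · simp [hx]
  · rintro ⟨φ, h1, h2⟩
    apply Subtype.ext
    funext x
    by_cases hx : x = e
    · subst hx
      have := h1 x
      simp at this
      simp [this]
    · simp [hx]

theorem cnt_loop [Field K] [Fintype K] [Fintype E] (G : Multigraph V E) (e : E)
    (h : G.fst e = G.snd e) :
    cnt G Set.univ (Set.univ : Set (V → K)) =
      (Fintype.card K - 1) * cnt G {x | x ≠ e} {h : V → K | ∃ g : V → K, h = g ∘ id} := by
  classical
  have hK : Nat.card {a : K // a ≠ 0} = Fintype.card K - 1 := by
    rw [Nat.card_eq_fintype_card, Fintype.card_subtype_compl, Fintype.card_subtype_eq]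
  have hupd : ∀ (φ : E → K) (c : K) (g : V → K),
      ∑ x, Function.update φ e c x * dd G g x = ∑ x, φ x * dd G g x := by
    intro φ c g
    apply Finset.sum_congr rfl
    intro x _
    by_cases hx : x = e
    · subst hx; simp [dd, h]
    · simp [hx]
  unfold cnt
  rw [← hK, ← Nat.card_prod]
  refine Nat.card_congr
      { toFun := fun φ => ⟨⟨φ.1 e, (φ.2.1 e).2 trivial⟩, ⟨Function.update φ.1 e 0, ?_, ?_⟩⟩
        invFun := fun φ => ⟨Function.update φ.2.1 e φ.1.1, ?_, ?_⟩
        left_inv := ?_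
        right_inv := ?_ }
  · intro x
    by_cases hx : x = e
    · subst hx; simp
    · have := φ.2.1 x
      simp [hx] at this ⊢
      exact this
  · rintro _ ⟨g, rfl⟩
    rw [hupd]
    exact φ.2.2 _ trivial
  · intro x
    by_cases hx : x = e
    · subst hx
      simp [φ.1.2]
    · have := φ.2.2.1 x
      simp [hx] at this ⊢
      exact this
  · intro g _
    rw [hupd]
    exact φ.2.2.2 g ⟨g, rfl⟩
  · rintro ⟨φ, h1, h2⟩
    apply Subtype.ext
    simp
  · rintro ⟨⟨c, hc⟩, ⟨φ, h1, h2⟩⟩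
    have := h1 e
    simp at this
    simp [← this]

end FlowAux

end

section
open Polynomial

namespace FlowAux
open Multigraph

variable {V E K : Type}

open Classical in
/-- Edges with both ends in `X`. -/
noncomputable def inn [Fintype E] (G : Multigraph V E) (X : Set V) : Finset E :=
  Finset.univ.filter fun e => G.fst e ∈ X ∧ G.snd e ∈ X

theorem mem_inn [Fintype E] (G : Multigraph V E) (X : Set V) (e : E) :
    e ∈ inn G X ↔ G.fst e ∈ X ∧ G.snd e ∈ X := by
  simp [inn]

/-- Boundary equation on the `X` side. -/
def bdy [Field K] [Fintype E] (G : Multigraph V E) (X : Set V) (ψ α : E → K) : Prop :=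
  ∀ g : V → K, (∀ v, v ∉ X → g v = 0) → ∑ e, (α e + ψ e) * dd G g e = 0

/-- The `X`-side completions of the cut values `ψ`. -/
def AX [Field K] [Fintype E] (G : Multigraph V E) (X : Set V) (ψ : E → K) : Type :=
  {α : E → K // (∀ e, α e ≠ 0 ↔ e ∈ inn G X) ∧ bdy G X ψ α}

/-- Cut values. -/
def Psi [Field K] [Fintype E] (G : Multigraph V E) (X : Set V) (ψ : E → K) : Prop :=
  ∀ e, ψ e ≠ 0 ↔ e ∈ cut G X

/-- Balanced cut values. -/
def Bal [Field K] [Fintype E] (G : Multigraph V E) (X : Set V) (ψ : E → K) : Prop :=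
  ∑ e, ψ e * dd G (ind K X) e = 0

theorem dd_cut [Field K] [Fintype E] (G : Multigraph V E) (X : Set V) (e : E) (he : e ∈ cut G X) :
    ∃ x ∈ X, ∀ g : V → K, (∀ v, v ∉ X → g v = 0) → dd G g e = dd G (ind K X) e * g x := by
  rw [mem_cut] at he
  by_cases h1 : G.fst e ∈ X
  · have h2 : G.snd e ∉ X := by tauto
    exact ⟨_, h1, fun g hg => by simp [dd, ind, h1, h2, hg]⟩
  · have h2 : G.snd e ∈ X := by tauto
    exact ⟨_, h2, fun g hg => by simp [dd, ind, h1, h2, hg]⟩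

theorem ind_supp [Field K] (X : Set V) : ∀ v, v ∉ X → ind K X v = 0 := by
  intro v hv; simp [ind, hv]

theorem ax_bal [Field K] [Fintype E] (G : Multigraph V E) (X : Set V) (ψ : E → K)
    (h : Nonempty (AX G X ψ)) : Bal G X ψ := by
  obtain ⟨α, h1, h2⟩ := h
  have := h2 (ind K X) (ind_supp X)
  unfold Bal
  rw [← this]
  apply Finset.sum_congr rfl
  intro e _
  by_cases he : e ∈ cut G X
  · have : α e = 0 := by
      by_contra h0
      have := (mem_inn G X e).1 ((h1 e).1 h0)
      rw [mem_cut] at he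
      tauto
    rw [this, zero_add]
  · rw [dd_ind_not G X e he]; simp

/-- Potential differences realized by functions supported on `A`. -/
def Rel [Fintype E] (G : Multigraph V E) (X : Set V) (K' : Type) [Field K'] (A : Finset E)
    (u v : V) : Prop :=
  ∃ α : E → K', (∀ e, α e ≠ 0 → e ∈ A) ∧
    ∀ g : V → K', (∀ v, v ∉ X → g v = 0) → ∑ e, α e * dd G g e = g v - g u

theorem solv [Field K] [Fintype E] (G : Multigraph V E) (X : Set V) (hc : (cut G X).card = 3)
    (A : Finset E) (hA : A ⊆ inn G X) (ψ ψ' : E → K) (h : Psi G X ψ) (h' : Psi G X ψ')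
    (b : Bal G X ψ) (b' : Bal G X ψ')
    (hs : ∃ α : E → K, (∀ e, α e ≠ 0 → e ∈ A) ∧ bdy G X ψ α) :
    ∃ α : E → K, (∀ e, α e ≠ 0 → e ∈ A) ∧ bdy G X ψ' α := by
  classical
  obtain ⟨e1, e2, e3, h12, h13, h23, hcut⟩ := Finset.card_eq_three.1 hc
  have sum3 : ∀ f : E → K, ∑ e ∈ cut G X, f e = f e1 + (f e2 + f e3) := by
    intro f
    rw [hcut, Finset.sum_insert (by simp [h12, h13]), Finset.sum_pair h23]
  have m1 : e1 ∈ cut G X := by simp [hcut]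
  have m2 : e2 ∈ cut G X := by simp [hcut]
  have m3 : e3 ∈ cut G X := by simp [hcut]
  obtain ⟨x1, hx1, d1⟩ := dd_cut (K := K) G X e1 m1
  obtain ⟨x2, hx2, d2⟩ := dd_cut (K := K) G X e2 m2
  obtain ⟨x3, hx3, d3⟩ := dd_cut (K := K) G X e3 m3
  have psum : ∀ ψ : E → K, Psi G X ψ → ∀ g : V → K, (∀ v, v ∉ X → g v = 0) →
      ∑ e, ψ e * dd G g e = ψ e1 * dd G (ind K X) e1 * g x1 +
        (ψ e2 * dd G (ind K X) e2 * g x2 + ψ e3 * dd G (ind K X) e3 * g x3) := by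
    intro ψ h g hg
    have : ∑ e, ψ e * dd G g e = ∑ e ∈ cut G X, ψ e * dd G g e := by
      symm
      apply Finset.sum_subset (Finset.subset_univ _)
      intro e _ he
      have : ψ e = 0 := by by_contra h0; exact he ((h e).1 h0)
      simp [this]
    rw [this, sum3, d1 g hg, d2 g hg, d3 g hg]; ring
  have bsum : ∀ ψ : E → K, Bal G X ψ → ψ e1 * dd G (ind K X) e1 +
        (ψ e2 * dd G (ind K X) e2 + ψ e3 * dd G (ind K X) e3) = 0 := by
    intro ψ h
    unfold Bal at h
    rwa [sum_ind, sum3] at h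
  have n1 : ψ e1 * dd G (ind K X) e1 ≠ 0 := mul_ne_zero ((h e1).2 m1) (dd_ind_ne G X e1 m1)
  have n2 : ψ e2 * dd G (ind K X) e2 ≠ 0 := mul_ne_zero ((h e2).2 m2) (dd_ind_ne G X e2 m2)
  have n3 : ψ e3 * dd G (ind K X) e3 ≠ 0 := mul_ne_zero ((h e3).2 m3) (dd_ind_ne G X e3 m3)
  have bs := bsum ψ b
  have bs' := bsum ψ' b'
  have ps := psum ψ h
  have ps' := psum ψ' h'
  generalize ψ e1 * dd G (ind K X) e1 = a1 at *
  generalize ψ e2 * dd G (ind K X) e2 = a2 at *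
  generalize ψ e3 * dd G (ind K X) e3 = a3 at *
  generalize ψ' e1 * dd G (ind K X) e1 = c1 at *
  generalize ψ' e2 * dd G (ind K X) e2 = c2 at *
  generalize ψ' e3 * dd G (ind K X) e3 = c3 at *
  have rrefl : ∀ u, Rel G X K A u u := fun u => ⟨0, by simp, by simp⟩
  have rsymm : ∀ u v, Rel G X K A u v → Rel G X K A v u := by
    rintro u v ⟨α, s, t⟩
    refine ⟨-α, by simpa using s, fun g hg => ?_⟩
    have := t g hg
    simp only [Pi.neg_apply, neg_mul, Finset.sum_neg_distrib, this]; ring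
  have rtrans : ∀ u v w, Rel G X K A u v → Rel G X K A v w → Rel G X K A u w := by
    rintro u v w ⟨α, s, t⟩ ⟨β, s', t'⟩
    refine ⟨α + β, fun e he => ?_, fun g hg => ?_⟩
    · by_contra hn
      have q1 : α e = 0 := by by_contra h0; exact hn (s e h0)
      have q2 : β e = 0 := by by_contra h0; exact hn (s' e h0)
      simp [q1, q2] at he
    · simp only [Pi.add_apply, add_mul, Finset.sum_add_distrib, t g hg, t' g hg]; ring
  have redge : ∀ e ∈ A, Rel G X K A (G.fst e) (G.snd e) := by
    intro e he
    refine ⟨Pi.single e 1, fun x hx => ?_, fun g hg => ?_⟩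
    · by_cases hxe : x = e
      · subst hxe; exact he
      · simp [hxe] at hx
    · rw [Finset.sum_eq_single e]
      · simp [dd]
      · intro x _ hx; simp [hx]
      · simp
  have hrel : Rel G X K A x1 x2 ∧ Rel G X K A x1 x3 := by
    obtain ⟨α, s, t⟩ := hs
    have ht := t (fun v => if v ∈ X ∧ Rel G X K A x1 v then 1 else 0)
      (fun v hv => by simp [hv])
    simp only [add_mul, Finset.sum_add_distrib] at ht
    rw [ps _ (fun v hv => by simp [hv]), Finset.sum_eq_zero, zero_add] at ht
    · simp only [hx1, hx2, hx3, rrefl, true_and, if_true] at ht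
      by_cases q2 : Rel G X K A x1 x2 <;> by_cases q3 : Rel G X K A x1 x3 <;>
        simp only [q2, q3, if_true, if_false] at ht ⊢
      · simp
      · exact absurd (by linear_combination bs - ht : a3 = 0) n3
      · exact absurd (by linear_combination bs - ht : a2 = 0) n2
      · exact absurd (by linear_combination ht : a1 = 0) n1
    · intro e _
      by_cases he : e ∈ A
      · have hi := (mem_inn G X e).1 (hA he)
        have : Rel G X K A x1 (G.fst e) ↔ Rel G X K A x1 (G.snd e) :=
          ⟨fun q => rtrans _ _ _ q (redge e he), fun q => rtrans _ _ _ q (rsymm _ _ (redge e he))⟩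
        simp [dd, hi, this]
      · have : α e = 0 := by by_contra h0; exact he (s e h0)
        simp [this]
  obtain ⟨⟨α, s, t⟩, ⟨β, s', t'⟩⟩ := hrel
  refine ⟨fun e => - c2 * α e - c3 * β e, fun e he => ?_, fun g hg => ?_⟩
  · by_contra hn
    have q1 : α e = 0 := by by_contra h0; exact hn (s e h0)
    have q2 : β e = 0 := by by_contra h0; exact hn (s' e h0)
    simp [q1, q2] at he
  · have : ∑ e, ((- c2 * α e - c3 * β e) + ψ' e) * dd G g e =
        - c2 * ∑ e, α e * dd G g e - c3 * ∑ e, β e * dd G g e + ∑ e, ψ' e * dd G g e := by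
      rw [Finset.mul_sum, Finset.mul_sum, ← Finset.sum_sub_distrib, ← Finset.sum_add_distrib]
      apply Finset.sum_congr rfl
      intro e _
      ring
    rw [this, t g hg, t' g hg, ps' g hg]
    linear_combination bs' * g x1

theorem ax_const [Field K] [Fintype K] [Fintype E] (G : Multigraph V E) (X : Set V)
    (hc : (cut G X).card = 3)
    (ψ ψ' : E → K) (h : Psi G X ψ) (h' : Psi G X ψ')
    (b : Bal G X ψ) (b' : Bal G X ψ') : Nat.card (AX G X ψ) = Nat.card (AX G X ψ') := by
  apply card_eq_of_sub (inn G X) (bdy G X ψ) (bdy G X ψ')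
  intro A hA
  by_cases hs : ∃ α : E → K, (∀ e, α e ≠ 0 → e ∈ A) ∧ bdy G X ψ α
  · obtain ⟨β, hb1, hb2⟩ := solv G X hc A hA ψ ψ' h h' b b' hs
    obtain ⟨α, ha1, ha2⟩ := hs
    have za : ∀ e, e ∉ A → α e = 0 := fun e he => by by_contra h0; exact he (ha1 e h0)
    have zb : ∀ e, e ∉ A → β e = 0 := fun e he => by by_contra h0; exact he (hb1 e h0)
    refine Nat.card_congr (Equiv.subtypeEquiv (Equiv.addRight (β - α)) ?_)
    intro γ
    apply and_congr
    · apply forall_congr'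
      intro e
      by_cases he : e ∈ A
      · simp [he]
      · simp [he, za e he, zb e he]
    · apply forall_congr'
      intro g
      apply forall_congr'
      intro hg
      have e1 := ha2 g hg
      have e2 := hb2 g hg
      have : ∑ e, ((Equiv.addRight (β - α)) γ e + ψ' e) * dd G g e = ∑ e, (γ e + ψ e) * dd G g e +
        ∑ e, (β e + ψ' e) * dd G g e - ∑ e, (α e + ψ e) * dd G g e := by
        rw [← Finset.sum_add_distrib, ← Finset.sum_sub_distrib]
        apply Finset.sum_congr rfl
        intro e _
        simp
        ring
      rw [this, e1, e2]; simp
  · have hs' : ¬ ∃ α : E → K, (∀ e, α e ≠ 0 → e ∈ A) ∧ bdy G X ψ' α := fun q =>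
      hs (solv G X hc A hA ψ' ψ h' h b' b q)
    have i1 : IsEmpty {φ : E → K // (∀ e, φ e ≠ 0 → e ∈ A) ∧ bdy G X ψ φ} :=
      ⟨fun φ => hs ⟨φ.1, φ.2⟩⟩
    have i2 : IsEmpty {φ : E → K // (∀ e, φ e ≠ 0 → e ∈ A) ∧ bdy G X ψ' φ} :=
      ⟨fun φ => hs' ⟨φ.1, φ.2⟩⟩
    rw [Nat.card_of_isEmpty, Nat.card_of_isEmpty]

open Classical in
/-- Collapse everything outside `X` to `y`. -/
noncomputable def col (X : Set V) (y : V) (v : V) : V := if v ∈ X then v else y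

theorem inn_cut_disj [Fintype E] (G : Multigraph V E) (X : Set V) (e : E) (h : e ∈ inn G X) :
    e ∉ cut G X := by
  rw [mem_inn] at h; rw [mem_cut]; tauto

theorem cnt_side [Field K] [Fintype K] [Fintype E] (G : Multigraph V E) (X : Set V) (y : V)
    (hy : y ∉ X) :
    cnt G {e | e ∈ inn G X ∨ e ∈ cut G X} {h : V → K | ∃ g : V → K, h = g ∘ col X y} =
      Nat.card (Σ ψ : {ψ : E → K // Psi G X ψ}, AX G X ψ.1) := by
  classical
  unfold cnt
  refine Nat.card_congr
    { toFun := fun φ => ⟨⟨fun e => if e ∈ cut G X then φ.1 e else 0, ?_⟩,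
        ⟨fun e => if e ∈ inn G X then φ.1 e else 0, ?_, ?_⟩⟩
      invFun := fun s => ⟨fun e => s.2.1 e + s.1.1 e, ?_, ?_⟩
      left_inv := ?_
      right_inv := ?_ }
  · intro e
    have := φ.2.1 e
    by_cases he : e ∈ cut G X <;> simp_all
  · intro e
    have := φ.2.1 e
    by_cases he : e ∈ inn G X <;> simp_all
  · intro g hg
    obtain ⟨φ, h1, h2⟩ := φ
    have hgc : g = g ∘ col X y := by
      funext v
      by_cases hv : v ∈ X <;> simp [col, hv, hg, hy]
    refine Eq.trans ?_ (h2 g ⟨g, hgc⟩)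
    apply Finset.sum_congr rfl
    intro e _
    have := h1 e
    have hd := inn_cut_disj G X e
    by_cases he : e ∈ inn G X
    · simp [he, hd he]
    · by_cases he' : e ∈ cut G X
      · simp [he, he']
      · simp [he, he'] at this
        simp [he, he', this]
  · intro e
    obtain ⟨⟨ψ, h1⟩, ⟨α, h2, h3⟩⟩ := s
    have hd := inn_cut_disj G X e
    have q1 := h1 e
    have q2 := h2 e
    change α e + ψ e ≠ 0 ↔ (e ∈ inn G X ∨ e ∈ cut G X)
    by_cases he : e ∈ inn G X
    · have hc := hd he
      simp only [he, hc, iff_true, iff_false, not_not] at q1 q2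
      simp [he, q1, q2]
    · simp only [he, iff_false, not_not] at q2
      simp only [he, false_or, q2, zero_add]
      exact q1
  · rintro _ ⟨g, rfl⟩
    obtain ⟨⟨ψ, h1⟩, ⟨α, h2, h3⟩⟩ := s
    have := h3 (fun v => (g ∘ col X y) v - g y) (fun v hv => by simp [col, hv])
    refine Eq.trans ?_ this
    apply Finset.sum_congr rfl
    intro e _
    simp [dd]
  · rintro ⟨φ, h1, h2⟩
    apply Subtype.ext
    funext e
    have := h1 e
    have hd := inn_cut_disj G X e
    by_cases he : e ∈ inn G X
    · simp [he, hd he]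
    · by_cases he' : e ∈ cut G X
      · simp [he, he']
      · simp [he, he'] at this
        simp [he, he', this]
  · rintro ⟨⟨ψ, h1⟩, ⟨α, h2, h3⟩⟩
    have z1 : ∀ e, e ∉ cut G X → ψ e = 0 := fun e he => by
      by_contra h0; exact he ((h1 e).1 h0)
    have z2 : ∀ e, e ∉ inn G X → α e = 0 := fun e he => by
      by_contra h0; exact he ((h2 e).1 h0)
    have r1 : (fun e => if e ∈ cut G X then α e + ψ e else 0) = ψ := by
      funext e
      by_cases he : e ∈ cut G X
      · have : e ∉ inn G X := fun q => inn_cut_disj G X e q he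
        simp [he, z2 e this]
      · simp [he, z1 e he]
    have r2 : (fun e => if e ∈ inn G X then α e + ψ e else 0) = α := by
      funext e
      by_cases he : e ∈ inn G X
      · simp [he, z1 e (inn_cut_disj G X e he)]
      · simp [he, z2 e he]
    apply Sigma.subtype_ext
    · apply Subtype.ext
      exact r1
    · exact r2

theorem tri_cases [Fintype E] (G : Multigraph V E) (X : Set V) (e : E) :
    (e ∈ inn G X ∧ e ∉ cut G X ∧ e ∉ inn G Xᶜ) ∨ (e ∉ inn G X ∧ e ∈ cut G X ∧ e ∉ inn G Xᶜ) ∨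
      (e ∉ inn G X ∧ e ∉ cut G X ∧ e ∈ inn G Xᶜ) := by
  simp only [mem_inn, mem_cut, Set.mem_compl_iff]; tauto

theorem sig_ext [Field K] [Fintype E] (G : Multigraph V E) (X : Set V)
    (s t : Σ ψ : {ψ : E → K // Psi G X ψ}, AX G X ψ.1 × AX G Xᶜ ψ.1)
    (h1 : s.1.1 = t.1.1) (h2 : s.2.1.1 = t.2.1.1) (h3 : s.2.2.1 = t.2.2.1) : s = t := by
  obtain ⟨⟨ψ, p⟩, ⟨α, a⟩, ⟨β, b⟩⟩ := s
  obtain ⟨⟨ψ', p'⟩, ⟨α', a'⟩, ⟨β', b'⟩⟩ := t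
  change ψ = ψ' at h1
  change α = α' at h2
  change β = β' at h3
  subst h1 h2 h3
  rfl

theorem cnt_split [Field K] [Fintype K] [Fintype E] (G : Multigraph V E) (X : Set V) :
    cnt G Set.univ (Set.univ : Set (V → K)) =
      Nat.card (Σ ψ : {ψ : E → K // Psi G X ψ}, AX G X ψ.1 × AX G Xᶜ ψ.1) := by
  classical
  unfold cnt
  have dzero : ∀ (X : Set V) (g : V → K) (e : E), (∀ v, v ∉ X → g v = 0) → e ∈ inn G Xᶜ →
      dd G g e = 0 := by
    intro X g e hg he
    rw [mem_inn] at he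
    simp [dd, hg _ he.1, hg _ he.2]
  refine Nat.card_congr
    { toFun := fun φ => ⟨⟨fun e => if e ∈ cut G X then φ.1 e else 0, ?_⟩,
        ⟨fun e => if e ∈ inn G X then φ.1 e else 0, ?_, ?_⟩,
        ⟨fun e => if e ∈ inn G Xᶜ then φ.1 e else 0, ?_, ?_⟩⟩
      invFun := fun s => ⟨fun e => s.2.1.1 e + s.1.1 e + s.2.2.1 e, ?_, ?_⟩
      left_inv := ?_
      right_inv := ?_ }
  · intro e
    have := φ.2.1 e
    by_cases he : e ∈ cut G X <;> simp_all
  · intro e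
    have := φ.2.1 e
    by_cases he : e ∈ inn G X <;> simp_all
  · intro g hg
    obtain ⟨φ, h1, h2⟩ := φ
    refine Eq.trans ?_ (h2 g trivial)
    apply Finset.sum_congr rfl
    intro e _
    rcases tri_cases G X e with ⟨q1, q2, q3⟩ | ⟨q1, q2, q3⟩ | ⟨q1, q2, q3⟩
    · simp [q1, q2]
    · simp [q1, q2]
    · simp [dzero X g e hg q3]
  · intro e
    have := φ.2.1 e
    by_cases he : e ∈ inn G Xᶜ <;> simp_all
  · intro g hg
    obtain ⟨φ, h1, h2⟩ := φ
    refine Eq.trans ?_ (h2 g trivial)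
    apply Finset.sum_congr rfl
    intro e _
    rcases tri_cases G X e with ⟨q1, q2, q3⟩ | ⟨q1, q2, q3⟩ | ⟨q1, q2, q3⟩
    · simp [dzero Xᶜ g e hg (by rwa [compl_compl])]
    · simp [q3, q2]
    · simp [q3, q2]
  · intro e
    obtain ⟨⟨ψ, h1⟩, ⟨α, h2, h3⟩, ⟨β, h4, h5⟩⟩ := s
    have p1 := h1 e
    have p2 := h2 e
    have p3 := h4 e
    rcases tri_cases G X e with ⟨q1, q2, q3⟩ | ⟨q1, q2, q3⟩ | ⟨q1, q2, q3⟩ <;>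
      simp only [q1, q2, q3, iff_true, iff_false, not_not] at p1 p2 p3 <;> simp_all
  · intro g _
    obtain ⟨⟨ψ, h1⟩, ⟨α, h2, h3⟩, ⟨β, h4, h5⟩⟩ := s
    have e1 := h3 (fun v => if v ∈ X then g v else 0) (fun v hv => by simp [hv])
    have e2 := h5 (fun v => if v ∈ X then 0 else g v) (fun v hv => by
      have : v ∈ X := by simpa using hv
      simp [this])
    have key : ∑ e, (α e + ψ e + β e) * dd G g e =
        ∑ e, (α e + ψ e) * dd G (fun v => if v ∈ X then g v else 0) e +
        ∑ e, (β e + ψ e) * dd G (fun v => if v ∈ X then 0 else g v) e := by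
      rw [← Finset.sum_add_distrib]
      apply Finset.sum_congr rfl
      intro e _
      have p1 := h1 e
      have p2 := h2 e
      have p3 := h4 e
      have sm : dd G g e = dd G (fun v => if v ∈ X then g v else 0) e +
          dd G (fun v => if v ∈ X then 0 else g v) e := by
        simp only [dd]
        split_ifs <;> ring
      rcases tri_cases G X e with ⟨q1, q2, q3⟩ | ⟨q1, q2, q3⟩ | ⟨q1, q2, q3⟩ <;>
        simp only [q1, q2, q3, iff_true, iff_false, not_not] at p1 p2 p3
      · rw [p1, p3, sm, dzero Xᶜ (fun v => if v ∈ X then 0 else g v) e (fun v hv => by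
          have : v ∈ X := by simpa using hv
          simp [this]) (by rwa [compl_compl])]
        ring
      · rw [p2, p3, sm]; ring
      · rw [p1, p2, sm, dzero X (fun v => if v ∈ X then g v else 0) e
          (fun v hv => by simp [hv]) q3]
        ring
    refine key.trans ?_
    rw [e1, e2, add_zero]
  · rintro ⟨φ, h1, h2⟩
    apply Subtype.ext
    funext e
    rcases tri_cases G X e with ⟨q1, q2, q3⟩ | ⟨q1, q2, q3⟩ | ⟨q1, q2, q3⟩ <;> simp [q1, q2, q3]
  · rintro ⟨⟨ψ, h1⟩, ⟨α, h2, h3⟩, ⟨β, h4, h5⟩⟩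
    have z1 : ∀ e, e ∉ cut G X → ψ e = 0 := fun e he => by
      by_contra h0; exact he ((h1 e).1 h0)
    have z2 : ∀ e, e ∉ inn G X → α e = 0 := fun e he => by
      by_contra h0; exact he ((h2 e).1 h0)
    have z3 : ∀ e, e ∉ inn G Xᶜ → β e = 0 := fun e he => by
      by_contra h0; exact he ((h4 e).1 h0)
    have r1 : (fun e => if e ∈ cut G X then α e + ψ e + β e else 0) = ψ := by
      funext e
      rcases tri_cases G X e with ⟨q1, q2, q3⟩ | ⟨q1, q2, q3⟩ | ⟨q1, q2, q3⟩ <;>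
        simp [q2, z1, z2, z3, q1, q3]
    have r2 : (fun e => if e ∈ inn G X then α e + ψ e + β e else 0) = α := by
      funext e
      rcases tri_cases G X e with ⟨q1, q2, q3⟩ | ⟨q1, q2, q3⟩ | ⟨q1, q2, q3⟩ <;>
        simp [q2, z1, z2, z3, q1, q3]
    have r3 : (fun e => if e ∈ inn G Xᶜ then α e + ψ e + β e else 0) = β := by
      funext e
      rcases tri_cases G X e with ⟨q1, q2, q3⟩ | ⟨q1, q2, q3⟩ | ⟨q1, q2, q3⟩ <;>
        simp [q2, z1, z2, z3, q1, q3]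
    exact sig_ext G X _ _ r1 r2 r3

theorem bal_compl [Field K] [Fintype E] (G : Multigraph V E) (X : Set V) (ψ : E → K) :
    Bal G Xᶜ ψ ↔ Bal G X ψ := by
  have : ∑ e, ψ e * dd G (ind K Xᶜ) e = - ∑ e, ψ e * dd G (ind K X) e := by
    rw [← Finset.sum_neg_distrib]
    apply Finset.sum_congr rfl
    intro e _
    by_cases h1 : G.fst e ∈ X <;> by_cases h2 : G.snd e ∈ X <;> simp [dd, ind, h1, h2]
  unfold Bal
  rw [this, neg_eq_zero]

theorem psi_compl [Field K] [Fintype E] (G : Multigraph V E) (X : Set V) (ψ : E → K) :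
    Psi G Xᶜ ψ ↔ Psi G X ψ := by
  unfold Psi
  rw [cut_compl]

theorem pairs_card [Field K] [Fintype K] :
    (Nat.card {ab : K × K // ab.1 ≠ 0 ∧ ab.2 ≠ 0 ∧ ab.1 + ab.2 ≠ 0} : ℤ) =
      (Fintype.card K - 1) * (Fintype.card K - 2) := by
  classical
  have e : {ab : K × K // ab.1 ≠ 0 ∧ ab.2 ≠ 0 ∧ ab.1 + ab.2 ≠ 0} ≃
      Σ a : {a : K // a ≠ 0}, {b : K // b ∈ (({0, -a.1} : Finset K)ᶜ)} :=
    { toFun := fun x => ⟨⟨x.1.1, x.2.1⟩, ⟨x.1.2, by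
        have h2 := x.2.2.1
        have h3 := x.2.2.2
        simp only [Finset.mem_compl, Finset.mem_insert, Finset.mem_singleton, not_or]
        exact ⟨h2, fun q => h3 (by rw [q]; ring)⟩⟩⟩
      invFun := fun y => ⟨⟨y.1.1, y.2.1⟩, y.1.2, by
        have h2 := y.2.2
        simp only [Finset.mem_compl, Finset.mem_insert, Finset.mem_singleton, not_or] at h2
        exact ⟨h2.1, fun q => h2.2 (by linear_combination q)⟩⟩
      left_inv := fun x => rfl
      right_inv := fun y => rfl }
  have h1 : 1 ≤ Fintype.card K := Fintype.card_pos
  have h2 : 2 ≤ Fintype.card K := Fintype.one_lt_card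
  have hK : Fintype.card {a : K // a ≠ 0} = Fintype.card K - 1 := by
    rw [Fintype.card_subtype_compl, Fintype.card_subtype_eq]
  rw [Nat.card_congr e, Nat.card_sigma, Finset.sum_congr rfl (g := fun _ => Fintype.card K - 2)]
  · rw [Finset.sum_const, Finset.card_univ, hK, smul_eq_mul]
    push_cast [h1, h2]
    ring
  · intro a _
    rw [Nat.card_eq_fintype_card, Fintype.card_coe, Finset.card_compl, Finset.card_pair]
    intro q
    exact a.2 (by rw [eq_comm, neg_eq_zero] at q; exact q)

theorem bal_card [Field K] [Fintype K] [Fintype E] (G : Multigraph V E) (X : Set V)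
    (hc : (cut G X).card = 3) :
    (Nat.card {ψ : E → K // Psi G X ψ ∧ Bal G X ψ} : ℤ) =
      (Fintype.card K - 1) * (Fintype.card K - 2) := by
  classical
  rw [← pairs_card]
  obtain ⟨e1, e2, e3, h12, h13, h23, hcut⟩ := Finset.card_eq_three.1 hc
  have sum3 : ∀ f : E → K, ∑ e ∈ cut G X, f e = f e1 + (f e2 + f e3) := by
    intro f
    rw [hcut, Finset.sum_insert (by simp [h12, h13]), Finset.sum_pair h23]
  have m1 : e1 ∈ cut G X := by simp [hcut]
  have m2 : e2 ∈ cut G X := by simp [hcut]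
  have m3 : e3 ∈ cut G X := by simp [hcut]
  have mem : ∀ e, e ∈ cut G X ↔ e = e1 ∨ e = e2 ∨ e = e3 := by intro e; simp [hcut]
  have s1 := dd_ind_sq (K := K) G X e1 m1
  have s2 := dd_ind_sq (K := K) G X e2 m2
  have s3 := dd_ind_sq (K := K) G X e3 m3
  have n1 := dd_ind_ne (K := K) G X e1 m1
  have n2 := dd_ind_ne (K := K) G X e2 m2
  have n3 := dd_ind_ne (K := K) G X e3 m3
  have bal : ∀ ψ : E → K, Bal G X ψ ↔ ψ e1 * dd G (ind K X) e1 +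
        (ψ e2 * dd G (ind K X) e2 + ψ e3 * dd G (ind K X) e3) = 0 := by
    intro ψ
    unfold Bal
    rw [sum_ind, sum3]
  generalize dd G (ind K X) e1 = c1 at *
  generalize dd G (ind K X) e2 = c2 at *
  generalize dd G (ind K X) e3 = c3 at *
  congr 1
  refine Nat.card_congr
    { toFun := fun ψ => ⟨⟨ψ.1 e1 * c1, ψ.1 e2 * c2⟩, ?_⟩
      invFun := fun ab => ⟨fun e => if e = e1 then ab.1.1 * c1 else if e = e2 then ab.1.2 * c2
        else if e = e3 then - (ab.1.1 + ab.1.2) * c3 else 0, ?_, ?_⟩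
      left_inv := ?_
      right_inv := ?_ }
  · obtain ⟨ψ, h1, h2⟩ := ψ
    have q1 := (h1 e1).2 m1
    have q2 := (h1 e2).2 m2
    have q3 := (h1 e3).2 m3
    rw [bal] at h2
    refine ⟨mul_ne_zero q1 n1, mul_ne_zero q2 n2, fun q => ?_⟩
    exact mul_ne_zero q3 n3 (by linear_combination h2 - q)
  · intro e
    obtain ⟨⟨a, b⟩, h1, h2, h3⟩ := ab
    rw [mem]
    simp only at h1 h2 h3
    have h4 : -b + -a ≠ 0 := fun q => h3 (by linear_combination -q)
    by_cases x1 : e = e1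
    · simp [x1, h1, n1]
    · by_cases x2 : e = e2
      · subst x2; simp [x1, h2, n2]
      · by_cases x3 : e = e3
        · subst x3; simp [x1, x2, h4, n3]
        · simp [x1, x2, x3]
  · rw [bal]
    obtain ⟨⟨a, b⟩, h1, h2, h3⟩ := ab
    simp only [if_true, h12.symm, h13.symm, h23.symm, if_false]
    linear_combination a * s1 + b * s2 - (a + b) * s3
  · rintro ⟨ψ, h1, h2⟩
    apply Subtype.ext
    funext e
    rw [bal] at h2
    by_cases x1 : e = e1
    · subst x1; simp; linear_combination ψ e * s1
    · by_cases x2 : e = e2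
      · subst x2; simp [x1]; linear_combination ψ e * s2
      · by_cases x3 : e = e3
        · subst x3
          simp [x1, x2]; linear_combination - c3 * h2 + ψ e * s3
        · have := h1 e
          rw [mem] at this
          simp only [x1, x2, x3, or_self, iff_false, not_not] at this
          simp [x1, x2, x3, this]
  · rintro ⟨⟨a, b⟩, h1, h2, h3⟩
    apply Subtype.ext
    apply Prod.ext
    · simp; linear_combination a * s1
    · simp [h12.symm]; linear_combination b * s2

theorem sum_bal [Field K] [Fintype K] [Fintype E] (G : Multigraph V E) (X : Set V)
    (N : (E → K) → ℕ) (c : ℕ) (h0 : ∀ ψ, Psi G X ψ → ¬ Bal G X ψ → N ψ = 0)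
    (h1 : ∀ ψ, Psi G X ψ → Bal G X ψ → N ψ = c) [Fintype {ψ : E → K // Psi G X ψ}] :
    ∑ ψ : {ψ : E → K // Psi G X ψ}, N ψ.1 =
      Nat.card {ψ : E → K // Psi G X ψ ∧ Bal G X ψ} * c := by
  classical
  have : ∀ ψ : {ψ : E → K // Psi G X ψ}, N ψ.1 = if Bal G X ψ.1 then c else 0 := by
    intro ψ
    split_ifs with h
    · exact h1 _ ψ.2 h
    · exact h0 _ ψ.2 h
  simp only [this]
  rw [Finset.sum_ite, Finset.sum_const, Finset.sum_const_zero, add_zero, smul_eq_mul,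
    ← Fintype.card_subtype, ← Nat.card_eq_fintype_card]
  congr 1
  exact Nat.card_congr (Equiv.subtypeSubtypeEquivSubtypeInter (fun ψ => Psi G X ψ) (fun ψ => Bal G X ψ))

theorem ax_zero [Field K] [Fintype E] (G : Multigraph V E) (X : Set V) (ψ : E → K)
    (h : ¬ Bal G X ψ) : Nat.card (AX G X ψ) = 0 := by
  have : IsEmpty (AX G X ψ) := ⟨fun a => h (ax_bal G X ψ ⟨a⟩)⟩
  exact Nat.card_of_isEmpty

theorem ax_finite [Field K] [Fintype K] [Fintype E] (G : Multigraph V E) (X : Set V) (ψ : E → K) :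
    Finite (AX G X ψ) := by
  unfold AX; infer_instance

theorem cnt_cut3 [Field K] [Fintype K] [Fintype E] (G : Multigraph V E) (X : Set V)
    (hc : (cut G X).card = 3) (y y' : V) (hy : y ∉ X) (hy' : y' ∉ Xᶜ) :
    ((Fintype.card K : ℤ) - 1) * (Fintype.card K - 2) * cnt G Set.univ (Set.univ : Set (V → K)) =
      cnt G {e | e ∈ inn G X ∨ e ∈ cut G X} {h : V → K | ∃ g : V → K, h = g ∘ col X y} *
      cnt G {e | e ∈ inn G Xᶜ ∨ e ∈ cut G Xᶜ} {h : V → K | ∃ g : V → K, h = g ∘ col Xᶜ y'} := by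
  classical
  have fin : ∀ X : Set V, ∀ ψ : E → K, Finite (AX G X ψ) := fun X ψ => ax_finite G X ψ
  have hc' : (cut G Xᶜ).card = 3 := by rw [cut_compl]; exact hc
  rw [cnt_split G X, cnt_side G X y hy, cnt_side G Xᶜ y' hy', ← bal_card (K := K) G X hc]
  by_cases hB : ∃ ψ : E → K, Psi G X ψ ∧ Bal G X ψ
  · obtain ⟨ψ₀, p0, b0⟩ := hB
    have k1 : Nat.card (Σ ψ : {ψ : E → K // Psi G X ψ}, AX G X ψ.1 × AX G Xᶜ ψ.1) =
        Nat.card {ψ : E → K // Psi G X ψ ∧ Bal G X ψ} *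
          (Nat.card (AX G X ψ₀) * Nat.card (AX G Xᶜ ψ₀)) := by
      rw [Nat.card_sigma]
      refine sum_bal G X (fun ψ => Nat.card (AX G X ψ × AX G Xᶜ ψ)) _ ?_ ?_
      · intro ψ _ h; simp only [Nat.card_prod, ax_zero G X ψ h, zero_mul]
      · intro ψ p b
        simp only [Nat.card_prod]
        rw [ax_const G X hc ψ ψ₀ p p0 b b0, ax_const G Xᶜ hc' ψ ψ₀ ((psi_compl G X ψ).2 p)
          ((psi_compl G X ψ₀).2 p0) ((bal_compl G X ψ).2 b) ((bal_compl G X ψ₀).2 b0)]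
    have k2 : Nat.card (Σ ψ : {ψ : E → K // Psi G X ψ}, AX G X ψ.1) =
        Nat.card {ψ : E → K // Psi G X ψ ∧ Bal G X ψ} * Nat.card (AX G X ψ₀) := by
      rw [Nat.card_sigma]
      refine sum_bal G X (fun ψ => Nat.card (AX G X ψ)) _ ?_ ?_
      · intro ψ _ h; exact ax_zero G X ψ h
      · intro ψ p b; exact ax_const G X hc ψ ψ₀ p p0 b b0
    have k3 : Nat.card (Σ ψ : {ψ : E → K // Psi G Xᶜ ψ}, AX G Xᶜ ψ.1) =
        Nat.card {ψ : E → K // Psi G Xᶜ ψ ∧ Bal G Xᶜ ψ} * Nat.card (AX G Xᶜ ψ₀) := by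
      rw [Nat.card_sigma]
      refine sum_bal G Xᶜ (fun ψ => Nat.card (AX G Xᶜ ψ)) _ ?_ ?_
      · intro ψ _ h; exact ax_zero G Xᶜ ψ h
      · intro ψ p b; exact ax_const G Xᶜ hc' ψ ψ₀ p ((psi_compl G X ψ₀).2 p0) b
          ((bal_compl G X ψ₀).2 b0)
    have k4 : Nat.card {ψ : E → K // Psi G Xᶜ ψ ∧ Bal G Xᶜ ψ} =
        Nat.card {ψ : E → K // Psi G X ψ ∧ Bal G X ψ} :=
      Nat.card_congr (Equiv.subtypeEquivRight fun ψ => by rw [psi_compl, bal_compl])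
    rw [k1, k2, k3, k4]
    push_cast
    ring
  · have k0 : Nat.card {ψ : E → K // Psi G X ψ ∧ Bal G X ψ} = 0 := by
      have : IsEmpty {ψ : E → K // Psi G X ψ ∧ Bal G X ψ} := ⟨fun ψ => hB ⟨ψ.1, ψ.2⟩⟩
      exact Nat.card_of_isEmpty
    have k2 : Nat.card (Σ ψ : {ψ : E → K // Psi G X ψ}, AX G X ψ.1) = 0 := by
      have : IsEmpty (Σ ψ : {ψ : E → K // Psi G X ψ}, AX G X ψ.1) :=
        ⟨fun s => hB ⟨s.1.1, s.1.2, ax_bal G X _ ⟨s.2⟩⟩⟩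
      exact Nat.card_of_isEmpty
    rw [k0, k2]
    simp

end FlowAux

end

section
open Polynomial

namespace FlowAux
open Multigraph

variable {V E : Type}

theorem eval_mp [Fintype V] [Fintype E] (G : Multigraph V E) (f : V → V) (S : Set E) (p : ℕ)
    [Fact p.Prime] : (mp G f S).flowPoly.eval (p : ℝ) =
      cnt G S {h : V → ZMod p | ∃ g : V → ZMod p, h = g ∘ f} := by
  let : Fintype S := Fintype.ofFinite S
  let : Fintype (Set.range f) := Fintype.ofFinite _
  rw [eval_flow (mp G f S) p, cnt_mp]

theorem flow_loop [Fintype V] [Fintype E] (G : Multigraph V E) (e : E) (h : G.fst e = G.snd e) :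
    G.flowPoly = (X - 1) * (mp G id {x | x ≠ e}).flowPoly := by
  apply poly_ext
  intro p hp
  have := Fact.mk hp
  rw [eval_mul, eval_mp, eval_flow, cnt_loop G e h, ZMod.card]
  have := hp.one_lt.le
  push_cast [this]
  simp

theorem flow_cut0 [Fintype V] [Fintype E] (G : Multigraph V E) (X : Set V) (u v : V)
    (hu : u ∈ X) (hv : v ∉ X) (h : cut G X = ∅) :
    G.flowPoly = (mp G (idf u v) Set.univ).flowPoly := by
  apply poly_ext
  intro p hp
  have := Fact.mk hp
  rw [eval_mp, eval_flow, cnt_cut0 G X u v hu hv h]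

theorem flow_cut1 [Fintype V] [Fintype E] (G : Multigraph V E) (X : Set V)
    (h : (cut G X).card = 1) : G.flowPoly = 0 := by
  apply poly_ext
  intro p hp
  have := Fact.mk hp
  rw [eval_flow, cnt_cut1 G X h]
  simp

theorem flow_cut2 [Fintype V] [Fintype E] (G : Multigraph V E) (X : Set V) (u v : V)
    (hu : u ∈ X) (hv : v ∉ X) (e f : E) (hef : e ≠ f) (h : ∀ x, x ∈ cut G X ↔ x = e ∨ x = f)
    (huv : (G.fst e = u ∧ G.snd e = v) ∨ (G.fst e = v ∧ G.snd e = u)) :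
    G.flowPoly = (mp G (idf u v) {x | x ≠ e}).flowPoly := by
  apply poly_ext
  intro p hp
  have := Fact.mk hp
  rw [eval_mp, eval_flow, cnt_cut2 G X u v hu hv e f hef h huv]

theorem flow_cut3 [Fintype V] [Fintype E] (G : Multigraph V E) (X : Set V)
    (hc : (cut G X).card = 3) (y y' : V) (hy : y ∉ X) (hy' : y' ∉ Xᶜ) :
    ((Polynomial.X - 1) * (Polynomial.X - 2)) * G.flowPoly =
      (mp G (col X y) {e | e ∈ inn G X ∨ e ∈ cut G X}).flowPoly *
      (mp G (col Xᶜ y') {e | e ∈ inn G Xᶜ ∨ e ∈ cut G Xᶜ}).flowPoly := by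
  apply poly_ext
  intro p hp
  have := Fact.mk hp
  have := cnt_cut3 (K := ZMod p) G X hc y y' hy hy'
  rw [ZMod.card] at this
  rw [eval_mul, eval_mul (p := (mp _ _ _).flowPoly), eval_mp, eval_mp, eval_flow]
  simp only [eval_mul, eval_sub, eval_X, eval_one, eval_ofNat]
  exact_mod_cast congrArg (fun z : ℤ => (z : ℝ)) this

theorem flow_empty [Fintype V] [Fintype E] [IsEmpty E] (G : Multigraph V E) :
    G.flowPoly = 1 := by
  apply poly_ext
  intro p hp
  have := Fact.mk hp
  rw [eval_flow]
  unfold cnt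
  have : Nat.card {φ : E → ZMod p // (∀ e, φ e ≠ 0 ↔ e ∈ Set.univ) ∧
    ∀ g ∈ (Set.univ : Set (V → ZMod p)), ∑ e, φ e * dd G g e = 0} = 1 := by
    rw [Nat.card_eq_one_iff_unique]
    exact ⟨⟨fun a b => Subtype.ext (Subsingleton.elim _ _)⟩,
      ⟨⟨fun e => isEmptyElim e, fun e => isEmptyElim e, fun g _ => by simp⟩⟩⟩
  rw [this]; simp

/-- All flow roots real implies all flow roots are in `{1,2,3}`. -/
def Good (F : ℝ[X]) : Prop :=
  (∀ z : ℂ, aeval z F = 0 → z.im = 0) → ∀ z : ℂ, aeval z F = 0 → z = 1 ∨ z = 2 ∨ z = 3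

theorem good_zero : Good 0 := by
  intro h
  have := h Complex.I (by simp)
  simp at this

theorem good_one : Good 1 := by
  intro h z hz
  simp at hz

theorem good_loop (F : ℝ[X]) (h : Good F) : Good ((X - 1) * F) := by
  intro hr z hz
  rw [map_mul, mul_eq_zero] at hz
  rcases hz with hz | hz
  · left
    simp only [map_sub, aeval_X, map_one] at hz
    linear_combination hz
  · exact h (fun w hw => hr w (by rw [map_mul, hw, mul_zero])) z hz

theorem good_cut3 (F F1 F2 : ℝ[X]) (h1 : Good F1) (h2 : Good F2)
    (h : ((X - 1) * (X - 2)) * F = F1 * F2) : Good F := by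
  intro hr z hz
  have key : ∀ w : ℂ, (w - 1) * (w - 2) * aeval w F = aeval w F1 * aeval w F2 := by
    intro w
    have := congrArg (aeval w) h
    have h2 : (aeval w (2 : ℝ[X]) : ℂ) = 2 := map_ofNat (aeval w) 2
    simpa [h2] using this
  have real : ∀ w : ℂ, aeval w F1 * aeval w F2 = 0 → w.im = 0 := by
    intro w hw
    rw [← key, mul_eq_zero, mul_eq_zero] at hw
    rcases hw with (hw | hw) | hw
    · have : w = 1 := by linear_combination hw
      simp [this]
    · have : w = 2 := by linear_combination hw
      simp [this]
    · exact hr w hw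
  have hk := key z
  rw [hz, mul_zero] at hk
  rcases mul_eq_zero.1 hk.symm with q | q
  · exact h1 (fun w hw => real w (by rw [hw, zero_mul])) z q
  · exact h2 (fun w hw => real w (by rw [hw, mul_zero])) z q

end FlowAux

end

section
open Polynomial

namespace FlowAux
open Multigraph

variable {V E : Type}

theorem mk_eq_of_mem (G : Multigraph V E) (A : Set E) (e : E) (he : e ∈ A) :
    Quotient.mk (G.reachSetoid A) (G.fst e) = Quotient.mk (G.reachSetoid A) (G.snd e) :=
  Quotient.sound (Relation.EqvGen.rel _ _ ⟨e, he, Or.inl ⟨rfl, rfl⟩⟩)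

theorem class_cut [Fintype E] (G : Multigraph V E) (A : Finset E)
    (q : Quotient (G.reachSetoid ↑A)) [DecidableEq E] :
    cut G {v | Quotient.mk (G.reachSetoid ↑A) v = q} ⊆ Aᶜ := by
  intro e he
  rw [Finset.mem_compl]
  intro h
  rw [mem_cut] at he
  have := mk_eq_of_mem G (↑A) e h
  apply he
  simp only [Set.mem_ofPred_eq, this]

theorem comp_bound [Fintype V] [Fintype E] [DecidableEq E] (G : Multigraph V E) (A : Finset E)
    (h3 : ∀ X : Set V, X.Nonempty → Xᶜ.Nonempty → 3 ≤ (cut G X).card) :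
    G.ncomp ↑A ≤ 1 ∨ 3 * G.ncomp ↑A ≤ 2 * (Aᶜ).card := by
  classical
  let Q := Quotient (G.reachSetoid ↑A)
  let _ : Fintype Q := Fintype.ofFinite Q
  have hq : G.ncomp ↑A = Fintype.card Q := Nat.card_eq_fintype_card
  by_cases h1 : G.ncomp ↑A ≤ 1
  · exact Or.inl h1
  right
  rw [hq] at h1 ⊢
  have : Nontrivial Q := Fintype.one_lt_card_iff_nontrivial.1 (by omega)
  let C : Q → Finset E := fun q => cut G {v | Quotient.mk (G.reachSetoid ↑A) v = q}
  have hC : ∀ q, 3 ≤ (C q).card := by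
    intro q
    apply h3
    · obtain ⟨v, hv⟩ := Quotient.exists_rep q
      exact ⟨v, hv⟩
    · obtain ⟨q', hq'⟩ := exists_ne q
      obtain ⟨v, hv⟩ := Quotient.exists_rep q'
      refine ⟨v, fun h => hq' ?_⟩
      rw [← hv]; exact h
  have s1 : 3 * Fintype.card Q ≤ ∑ q, (C q).card := by
    have := Finset.sum_le_sum (s := Finset.univ) (fun q _ => hC q)
    simpa [mul_comm] using this
  have s2 : ∑ q, (C q).card = ∑ e ∈ Aᶜ, (Finset.univ.filter fun q => e ∈ C q).card := by
    have : ∀ q, (C q).card = ∑ e ∈ Aᶜ, if e ∈ C q then 1 else 0 := by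
      intro q
      rw [← Finset.card_filter]
      congr 1
      ext e
      simp only [Finset.mem_filter]
      exact ⟨fun h => ⟨class_cut G A q h, h⟩, fun h => h.2⟩
    simp only [this]
    rw [Finset.sum_comm]
    simp only [Finset.card_filter]
  have s3 : ∑ e ∈ Aᶜ, (Finset.univ.filter fun q => e ∈ C q).card ≤ ∑ e ∈ Aᶜ, 2 := by
    apply Finset.sum_le_sum
    intro e _
    refine (Finset.card_le_card (t := {Quotient.mk (G.reachSetoid ↑A) (G.fst e),
      Quotient.mk (G.reachSetoid ↑A) (G.snd e)}) ?_).trans Finset.card_le_two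
    intro q hq
    have := (Finset.mem_filter.1 hq).2
    rw [mem_cut] at this
    simp only [Set.mem_ofPred_eq] at this
    simp only [Finset.mem_insert, Finset.mem_singleton]
    by_contra hh
    push Not at hh
    exact this ⟨fun h => absurd h.symm hh.1, fun h => absurd h.symm hh.2⟩
  rw [Finset.sum_const, smul_eq_mul] at s3
  omega

theorem handshake [Fintype V] [Fintype E] (G : Multigraph V E) (hl : ∀ e, G.fst e ≠ G.snd e) :
    ∑ v, (cut G {v}).card = 2 * Fintype.card E := by
  classical
  have : ∀ v, (cut G {v}).card = ∑ e, if e ∈ cut G {v} then 1 else 0 := by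
    intro v
    rw [← Finset.card_filter]
    congr 1
    ext e; simp
  simp only [this]
  rw [Finset.sum_comm]
  have h2 : ∀ e : E, (∑ v, if e ∈ cut G {v} then 1 else 0) = 2 := by
    intro e
    rw [← Finset.card_filter, ← Finset.card_pair (hl e)]
    congr 1
    ext v
    have := hl e
    simp only [Finset.mem_filter, Finset.mem_univ, true_and, mem_cut, Set.mem_singleton_iff,
      Finset.mem_insert, Finset.mem_singleton]
    constructor
    · intro h
      by_contra hh
      push Not at hh
      exact h ⟨fun q => absurd q.symm hh.1, fun q => absurd q.symm hh.2⟩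
    · rintro (rfl | rfl)
      · simp [this.symm]
      · simp [this]
  simp [h2, mul_comm]

theorem two_comp [Fintype V] [Fintype E] [DecidableEq E] (G : Multigraph V E) (A : Finset E)
    (h3 : ∀ X : Set V, X.Nonempty → Xᶜ.Nonempty → 3 ≤ (cut G X).card)
    (hs : ∀ X : Set V, X.Nonempty → Xᶜ.Nonempty → (cut G X).card = 3 →
      (∃ v, X = {v}) ∨ ∃ v, Xᶜ = {v})
    (hA : (Aᶜ).card = 3) (hc : G.ncomp ↑A = 2) : ∃ v, cut G {v} = Aᶜ := by
  classical
  let Q := Quotient (G.reachSetoid ↑A)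
  let _ : Fintype Q := Fintype.ofFinite Q
  have hq : G.ncomp ↑A = Fintype.card Q := Nat.card_eq_fintype_card
  have : Nontrivial Q := Fintype.one_lt_card_iff_nontrivial.1 (by omega)
  obtain ⟨q, q', hqq⟩ := exists_pair_ne Q
  let X : Set V := {v | Quotient.mk (G.reachSetoid ↑A) v = q}
  have n1 : X.Nonempty := by
    obtain ⟨v, hv⟩ := Quotient.exists_rep q
    exact ⟨v, hv⟩
  have n2 : Xᶜ.Nonempty := by
    obtain ⟨v, hv⟩ := Quotient.exists_rep q'
    refine ⟨v, fun h => hqq ?_⟩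
    rw [← hv]; exact h.symm
  have hsub : cut G X ⊆ Aᶜ := class_cut G A q
  have heq : cut G X = Aᶜ := Finset.eq_of_subset_of_card_le hsub (by rw [hA]; exact h3 X n1 n2)
  rcases hs X n1 n2 (by rw [heq, hA]) with ⟨v, hv⟩ | ⟨v, hv⟩
  · exact ⟨v, by rw [← hv, heq]⟩
  · exact ⟨v, by rw [← hv, cut_compl, heq]⟩

theorem core [Fintype V] [Fintype E] (G : Multigraph V E) (hn : 2 ≤ Fintype.card V)
    (hl : ∀ e, G.fst e ≠ G.snd e)
    (h3 : ∀ X : Set V, X.Nonempty → Xᶜ.Nonempty → 3 ≤ (cut G X).card)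
    (hs : ∀ X : Set V, X.Nonempty → Xᶜ.Nonempty → (cut G X).card = 3 →
      (∃ v, X = {v}) ∨ ∃ v, Xᶜ = {v}) : Good G.flowPoly := by
  classical
  have : Nontrivial V := Fintype.one_lt_card_iff_nontrivial.1 hn
  have hdeg : ∀ v, 3 ≤ (cut G {v}).card := by
    intro v
    apply h3 _ (Set.singleton_nonempty v)
    obtain ⟨w, hw⟩ := exists_ne v
    exact ⟨w, hw⟩
  have hhs := handshake G hl
  have hnm : 3 * Fintype.card V ≤ 2 * Fintype.card E := by
    rw [← hhs]
    have := Finset.sum_le_sum (s := Finset.univ) (fun v _ => hdeg v)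
    simpa [mul_comm] using this
  obtain ⟨r, hr⟩ : ∃ r, r + 2 + Fintype.card V = Fintype.card E + 1 :=
    ⟨Fintype.card E - 1 - Fintype.card V, by omega⟩
  have hF := flowPoly_eq G
  have hcl : ∀ A : Finset E, ∃ x, A.card + G.ncomp ↑A - Fintype.card V = x ∧
      x ≤ r + 2 ∧ (r + 2 = x ↔ A.card = Fintype.card E) ∧ (r + 1 = x ↔ A.card + 1 = Fintype.card E) ∧
      (r = x ↔ (A.card + 2 = Fintype.card E ∨ A.card + 3 = Fintype.card E ∧ G.ncomp ↑A = 2)) := by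
    intro A
    have h1 := (card_flow_sub (K := ZMod 2) G A).1
    have h2 := comp_bound G A h3
    have h4 := Finset.card_le_univ A
    rw [Finset.card_compl] at h2
    have h5 : 1 ≤ G.ncomp ↑A := by
      have : Nonempty (Quotient (G.reachSetoid ↑A)) := ⟨Quotient.mk _ (Classical.arbitrary V)⟩
      exact Nat.card_pos
    refine ⟨_, rfl, ?_, ?_, ?_, ?_⟩ <;> omega
  choose x hx hxle hx2 hx1 hx0 using hcl
  simp only [hx] at hF
  have hcoeff : ∀ k, G.flowPoly.coeff k = ∑ A : Finset E,
      if k = x A then (-1 : ℝ) ^ (Fintype.card E - A.card) else 0 := by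
    intro k
    rw [hF, finsetSum_coeff]
    apply Finset.sum_congr rfl
    intro A _
    have : ((-1 : ℝ[X]) ^ (Fintype.card E - A.card)) = C ((-1 : ℝ) ^ (Fintype.card E - A.card)) := by
      simp
    rw [this, coeff_C_mul, coeff_X_pow]
    simp
  let T : Finset (Finset E) := Finset.univ.filter fun A =>
    A.card + 3 = Fintype.card E ∧ G.ncomp ↑A = 2
  let W : Finset V := Finset.univ.filter fun v => (cut G {v}).card = 3
  have hTW : T.card ≤ W.card := by
    refine (Finset.card_le_card (t := W.image fun v => (cut G {v})ᶜ) ?_).trans Finset.card_image_le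
    intro A hA
    obtain ⟨a1, a2⟩ := (Finset.mem_filter.1 hA).2
    have a3 : (Aᶜ).card = 3 := by rw [Finset.card_compl]; omega
    obtain ⟨v, hv⟩ := two_comp G A h3 hs a3 a2
    refine Finset.mem_image.2 ⟨v, Finset.mem_filter.2 ⟨Finset.mem_univ _, by rw [hv, a3]⟩, ?_⟩
    rw [hv, compl_compl]
  have hWn : W.card ≤ Fintype.card V := Finset.card_le_univ W
  have hm : 0 < Fintype.card E := by omega
  refine an_main G.flowPoly (∑ A : Finset E, (-1 : ℤ[X]) ^ (Fintype.card E - A.card) * X ^ (x A))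
    (Fintype.card V) (Fintype.card E) T.card r ?_ hn hr ?_ ?_ ?_ ?_ ?_ (hTW.trans hWn) ?_
  · rw [hF, Polynomial.map_sum]
    simp
  · rw [hF]
    apply natDegree_sum_le_of_forall_le
    intro A _
    have : ((-1 : ℝ[X]) ^ (Fintype.card E - A.card)) = C ((-1 : ℝ) ^ (Fintype.card E - A.card)) := by
      simp
    rw [this]
    exact (natDegree_C_mul_X_pow_le _ _).trans (hxle A)
  · rw [hcoeff, Finset.sum_eq_single Finset.univ]
    · rw [if_pos ((hx2 _).2 Finset.card_univ)]
      simp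
    · intro A _ hA
      rw [if_neg]
      intro h
      exact hA ((Finset.card_eq_iff_eq_univ A).1 ((hx2 A).1 h))
    · simp
  · rw [hcoeff, ← Finset.sum_filter]
    have : (Finset.univ.filter fun A : Finset E => r + 1 = x A) =
        Finset.powersetCard (Fintype.card E - 1) Finset.univ := by
      ext A
      simp only [Finset.mem_filter, Finset.mem_univ, true_and, Finset.mem_powersetCard,
        Finset.subset_univ, hx1]
      omega
    rw [this, Finset.sum_congr rfl (g := fun _ => (-1 : ℝ))]
    · rw [Finset.sum_const, Finset.card_powersetCard, Finset.card_univ,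
        Nat.choose_symm (by omega : 1 ≤ Fintype.card E)]
      simp
    · intro A hA
      rw [(Finset.mem_powersetCard.1 hA).2, Nat.sub_sub_self (by omega), pow_one]
  · rw [hcoeff, ← Finset.sum_filter]
    have : (Finset.univ.filter fun A : Finset E => r = x A) =
        Finset.powersetCard (Fintype.card E - 2) Finset.univ ∪ T := by
      ext A
      simp only [Finset.mem_filter, Finset.mem_univ, true_and, Finset.mem_powersetCard,
        Finset.subset_univ, hx0, Finset.mem_union, T]
      have : A.card + 2 = Fintype.card E ↔ A.card = Fintype.card E - 2 := by omega
      rw [this]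
    rw [this, Finset.sum_union, Finset.sum_congr rfl (g := fun _ => (1 : ℝ)),
      Finset.sum_congr (s₁ := T) rfl (g := fun _ => (-1 : ℝ))]
    · rw [Finset.sum_const, Finset.sum_const, Finset.card_powersetCard, Finset.card_univ,
        Nat.choose_symm (by omega : 2 ≤ Fintype.card E), nsmul_eq_mul, nsmul_eq_mul,
        Nat.cast_choose_two]
      ring
    · intro A hA
      obtain ⟨a1, a2⟩ := (Finset.mem_filter.1 hA).2
      have : Fintype.card E - A.card = 3 := by omega
      rw [this]; norm_num
    · intro A hA
      have := (Finset.mem_powersetCard.1 hA).2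
      have : Fintype.card E - A.card = 2 := by omega
      rw [this]; norm_num
    · rw [Finset.disjoint_left]
      intro A hA hA'
      have h1 := (Finset.mem_powersetCard.1 hA).2
      obtain ⟨a1, a2⟩ := (Finset.mem_filter.1 hA').2
      omega
  · rw [hF, eval_finsetSum]
    have : Nonempty E := Fintype.card_pos_iff.1 hm
    have h0 := Finset.sum_powerset_neg_one_pow_card_of_nonempty
      (Finset.univ_nonempty (α := E))
    rw [Finset.powerset_univ] at h0
    have h0' : ∑ A : Finset E, (-1 : ℝ) ^ A.card = 0 := by exact_mod_cast h0
    have : ∀ A : Finset E, ((-1 : ℝ[X]) ^ (Fintype.card E - A.card) * X ^ (x A)).eval 1 =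
        (-1) ^ Fintype.card E * (-1 : ℝ) ^ A.card := by
      intro A
      have h4 := Finset.card_le_univ A
      obtain ⟨k, hk⟩ := Nat.exists_eq_add_of_le h4
      rw [hk]
      simp [pow_add]
      rw [mul_right_comm, ← mul_pow]; simp
    simp only [this]
    rw [← Finset.mul_sum, h0', mul_zero]
  · intro ht
    have hW : W = Finset.univ := (Finset.card_eq_iff_eq_univ W).1 (by omega)
    have : ∀ v, (cut G {v}).card = 3 := fun v =>
      (Finset.mem_filter.1 (by rw [hW]; exact Finset.mem_univ v : v ∈ W)).2
    rw [← hhs]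
    simp [this, mul_comm]

theorem card_lt [Fintype V] (f : V → V) (u v : V) (huv : u ≠ v) (h : f u = f v)
    [Fintype (Set.range f)] :
    Fintype.card (Set.range f) < Fintype.card V := by
  apply Fintype.card_lt_of_surjective_not_injective (Set.rangeFactorization f)
    Set.rangeFactorization_surjective
  intro hi
  exact huv (hi (Subtype.ext h))

theorem main_aux (N : ℕ) : ∀ (V E : Type) [Fintype V] [Fintype E] (G : Multigraph V E),
    Fintype.card V + Fintype.card E ≤ N → Good G.flowPoly := by
  induction N with
  | zero =>
    intro V E _ _ G h
    have : IsEmpty E := Fintype.card_eq_zero_iff.1 (by omega)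
    rw [flow_empty G]; exact good_one
  | succ N ih =>
    intro V E _ _ G h
    classical
    have ih1 : ∀ (f : V → V) (S : Set E), (∃ u v, u ≠ v ∧ f u = f v) → Good (mp G f S).flowPoly := by
      rintro f S ⟨u, v, huv, hf⟩
      let _ : Fintype S := Fintype.ofFinite S
      let _ : Fintype (Set.range f) := Fintype.ofFinite _
      apply ih _ _ (mp G f S)
      have := card_lt f u v huv hf
      have h9 : Fintype.card S ≤ Fintype.card E :=
        Fintype.card_le_of_injective (Subtype.val : S → E) Subtype.val_injective
      omega
    by_cases hl : ∀ e, G.fst e ≠ G.snd e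
    swap
    · push Not at hl
      obtain ⟨e, he⟩ := hl
      rw [flow_loop G e he]
      apply good_loop
      let _ : Fintype {x | x ≠ e} := Fintype.ofFinite _
      let _ : Fintype (Set.range (id : V → V)) := Fintype.ofFinite _
      apply ih _ _ (mp G id {x | x ≠ e})
      have h1 : Fintype.card {x | x ≠ e} < Fintype.card E :=
        Fintype.card_lt_of_injective_of_notMem (Subtype.val : {x | x ≠ e} → E)
          Subtype.val_injective (b := e) (by simp)
      have h2 : Fintype.card (Set.range (id : V → V)) ≤ Fintype.card V :=
        Fintype.card_le_of_injective (Subtype.val : Set.range (id : V → V) → V)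
        Subtype.val_injective
      omega
    by_cases hn : 2 ≤ Fintype.card V
    swap
    · have : Subsingleton V := Fintype.card_le_one_iff_subsingleton.1 (by omega)
      have : IsEmpty E := ⟨fun e => hl e (Subsingleton.elim _ _)⟩
      rw [flow_empty G]; exact good_one
    have hidf : ∀ u v : V, u ≠ v → ∃ a b, a ≠ b ∧ idf u v a = idf u v b := by
      intro u v huv
      exact ⟨u, v, huv, by simp [idf]⟩
    by_cases h3 : ∀ X : Set V, X.Nonempty → Xᶜ.Nonempty → 3 ≤ (cut G X).card
    swap
    · push Not at h3
      obtain ⟨X, ⟨u, hu⟩, ⟨v, hv⟩, hX⟩ := h3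
      have huv : u ≠ v := by rintro rfl; exact hv hu
      interval_cases hk : (cut G X).card
      · rw [flow_cut0 G X u v hu hv (Finset.card_eq_zero.1 hk)]
        exact ih1 _ _ (hidf u v huv)
      · rw [flow_cut1 G X hk]; exact good_zero
      · obtain ⟨e, f, hef, hcut⟩ := Finset.card_eq_two.1 hk
        have hmem : ∀ x, x ∈ cut G X ↔ x = e ∨ x = f := by intro x; simp [hcut]
        have he := (hmem e).2 (Or.inl rfl)
        rw [mem_cut] at he
        by_cases h1 : G.fst e ∈ X
        · have h2 : G.snd e ∉ X := by tauto
          rw [flow_cut2 G X _ _ h1 h2 e f hef hmem (Or.inl ⟨rfl, rfl⟩)]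
          exact ih1 _ _ (hidf _ _ (hl e))
        · have h2 : G.snd e ∈ X := by tauto
          rw [flow_cut2 G X _ _ h2 h1 e f hef hmem (Or.inr ⟨rfl, rfl⟩)]
          exact ih1 _ _ (hidf _ _ (hl e).symm)
    by_cases hs : ∀ X : Set V, X.Nonempty → Xᶜ.Nonempty → (cut G X).card = 3 →
      (∃ v, X = {v}) ∨ ∃ v, Xᶜ = {v}
    swap
    · push Not at hs
      obtain ⟨X, ⟨u, hu⟩, ⟨v, hv⟩, hX, g1, g2⟩ := hs
      have hcol : ∀ (X : Set V) (y v : V), v ∈ Xᶜ → (∀ w, Xᶜ ≠ {w}) →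
          ∃ a b, a ≠ b ∧ col X y a = col X y b := by
        intro X y v hv hw
        by_contra hh
        push Not at hh
        apply hw v
        ext w
        constructor
        · intro hwX
          by_contra hne
          apply hh w v hne
          have a1 : w ∉ X := hwX
          have a2 : v ∉ X := hv
          simp [col, a1, a2]
        · rintro rfl; exact hv
      have hu' : u ∉ Xᶜ := fun q => q hu
      refine good_cut3 _ _ _ ?_ ?_ (flow_cut3 G X hX v u hv hu')
      · exact ih1 _ _ (hcol X v v hv g2)
      · exact ih1 _ _ (hcol Xᶜ u u (by rwa [compl_compl]) (by rwa [compl_compl]))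
    exact core G hn hl h3 hs

end FlowAux


end

open Multigraph Polynomial in
/-- Dong. Let `G = (V,E)` be a bridgeless finite multigraph all of
whose complex flow roots are real. If some flow root of `G` is not in `{1,2,3}`, then
`|V| + 17 ≤ |E| < (32|V| − 49)/5` and `F(G,q)` has at least `9` roots (with
multiplicity) in the open interval `(1,2)`. -/
theorem flowPoly_real_roots_structure {V E : Type} [Fintype V] [Fintype E]
    (G : Multigraph V E) (hbl : G.Bridgeless)
    (hreal : ∀ z ∈ (G.flowPoly.map (algebraMap ℝ ℂ)).roots, z.im = 0)
    (hnot : ∃ z ∈ (G.flowPoly.map (algebraMap ℝ ℂ)).roots, z ≠ 1 ∧ z ≠ 2 ∧ z ≠ 3) :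
    (Fintype.card V + 17 ≤ Fintype.card E ∧
      (Fintype.card E : ℝ) < (32 * Fintype.card V - 49) / 5) ∧
      9 ≤ (G.flowPoly.roots.filter fun x : ℝ => 1 < x ∧ x < 2).card := by
  exfalso
  obtain ⟨z, hz, h1, h2, h3⟩ := hnot
  have hne : G.flowPoly.map (algebraMap ℝ ℂ) ≠ 0 := (mem_roots'.1 hz).1
  have hroot : ∀ w : ℂ, w ∈ (G.flowPoly.map (algebraMap ℝ ℂ)).roots ↔ aeval w G.flowPoly = 0 := by
    intro w
    rw [mem_roots hne, IsRoot.def, eval_map_algebraMap]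
  have := FlowAux.main_aux _ V E G le_rfl (fun w hw => hreal w ((hroot w).2 hw)) z ((hroot z).1 hz)
  tauto
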